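/- High-frequency trilinear L^{3/2} estimate in ℝ^{3+1}. Let s ∈ (5/6, 1) and let ε > 0 be sufficiently small. There is a constant C = C(s, ε, m₁) such that for all Schwartz functions φ₁, φ₂, φ₃ on ℝ³ × ℝ such that the spatial Fourier transforms of φ₂ and φ₃ are supported in {ξ : |ξ| ≥ 1/2} for every t, one has ‖(∇ I φ₁) · φ₂ · φ₃‖_{L^{3/2}_{t,x}(ℝ × ℝ³)} ≤ C ‖∇ I φ₁‖_{X_{0, 1/2+ε}} ‖∇ I φ₂‖_{X_{0, 1/2+ε}} ‖∇ I φ₃‖_{X_{0, 1/2+ε}}, where I := I₁ is the operator with multiplier m₁. -/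

import Mathlib

open MeasureTheory Complex Set
open scoped FourierTransform BigOperators RealInnerProductSpace

noncomputable section

abbrev Rn (n : ℕ) := EuclideanSpace ℝ (Fin n)

/-- Japanese bracket of a vector. -/
def jap {n : ℕ} (ξ : Rn n) : ℝ := Real.sqrt (1 + ‖ξ‖ ^ 2)

/-- Japanese bracket of a real number. -/
def japR (x : ℝ) : ℝ := Real.sqrt (1 + x ^ 2)

/-- Inhomogeneous Sobolev norm ‖⟨ξ⟩^s f̂‖_{L²}. -/
def sobNorm (n : ℕ) (s : ℝ) (f : Rn n → ℂ) : ℝ :=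
  (∫ ξ : Rn n, jap ξ ^ (2 * s) * ‖𝓕 f ξ‖ ^ 2) ^ (1/2 : ℝ)

/-- Homogeneous Sobolev norm ‖|ξ|^s f̂‖_{L²}. -/
def sobNormHom (n : ℕ) (s : ℝ) (f : Rn n → ℂ) : ℝ :=
  (∫ ξ : Rn n, ‖ξ‖ ^ (2 * s) * ‖𝓕 f ξ‖ ^ 2) ^ (1/2 : ℝ)

/-- L^p norm on ℝⁿ. -/
def lpNorm (n : ℕ) (p : ℝ) (f : Rn n → ℂ) : ℝ :=
  (∫ x : Rn n, ‖f x‖ ^ p) ^ (1/p)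

/-- Laplacian: sum of second partial derivatives. -/
def laplacian {n : ℕ} (f : Rn n → ℂ) (x : Rn n) : ℂ :=
  ∑ i : Fin n, fderiv ℝ (fun y => fderiv ℝ f y (EuclideanSpace.single i 1)) x
    (EuclideanSpace.single i 1)

/-- Complex gradient as a vector in Euclidean space. -/
def gradC {n : ℕ} (f : Rn n → ℂ) (x : Rn n) : EuclideanSpace ℂ (Fin n) :=
  (WithLp.equiv 2 (Fin n → ℂ)).symm fun i => fderiv ℝ f x (EuclideanSpace.single i 1)

/-- φ is a solution of the cubic defocussing NLS on ℝⁿ × [0,T] with data φ₀: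
smooth, Schwartz in x uniformly for t ∈ [0,T] (with all derivatives),
satisfying i∂ₜφ + Δφ = |φ|²φ and φ(·,0) = φ₀. -/
def IsNLSSolution (n : ℕ) (T : ℝ) (φ : Rn n → ℝ → ℂ) (φ₀ : Rn n → ℂ) : Prop :=
  ContDiff ℝ (⊤ : ℕ∞) (fun p : Rn n × ℝ => φ p.1 p.2) ∧
  (∀ k l : ℕ, ∃ C : ℝ, ∀ t ∈ Icc (0:ℝ) T, ∀ x : Rn n,
      ‖x‖ ^ k * ‖iteratedFDeriv ℝ l (fun y => φ y t) x‖ ≤ C) ∧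
  (∀ x : Rn n, ∀ t ∈ Icc (0:ℝ) T,
      Complex.I * deriv (fun t' => φ x t') t + laplacian (fun y => φ y t) x
        = (‖φ x t‖ : ℂ) ^ 2 * φ x t) ∧
  (∀ x : Rn n, φ x 0 = φ₀ x)

/-- The energy E(f) = ∫ (1/2)|∇f|² + (1/4)|f|⁴. -/
def energy {n : ℕ} (f : Rn n → ℂ) : ℝ :=
  ∫ x : Rn n, ((1/2 : ℝ) * ∑ i : Fin n, ‖fderiv ℝ f x (EuclideanSpace.single i 1)‖ ^ 2
    + (1/4 : ℝ) * ‖f x‖ ^ 4)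

/-- m₁ is a smooth, radially symmetric, nonincreasing multiplier with
m₁ = 1 on the unit ball, m₁(ξ) = |ξ|^{-(1-s)} for |ξ| ≥ 2, 0 < m₁ ≤ 1. -/
def IsAdmissibleMultiplier (n : ℕ) (s : ℝ) (m₁ : Rn n → ℝ) : Prop :=
  ContDiff ℝ (⊤ : ℕ∞) m₁ ∧
  (∀ ξ : Rn n, 0 < m₁ ξ ∧ m₁ ξ ≤ 1) ∧
  (∀ ξ η : Rn n, ‖ξ‖ = ‖η‖ → m₁ ξ = m₁ η) ∧
  (∀ ξ η : Rn n, ‖ξ‖ ≤ ‖η‖ → m₁ η ≤ m₁ ξ) ∧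
  (∀ ξ : Rn n, ‖ξ‖ ≤ 1 → m₁ ξ = 1) ∧
  (∀ ξ : Rn n, 2 ≤ ‖ξ‖ → m₁ ξ = ‖ξ‖ ^ (-(1 - s)))

/-- The rescaled multiplier m_N(ξ) = m₁(ξ/N). -/
def mN {n : ℕ} (m₁ : Rn n → ℝ) (N : ℝ) (ξ : Rn n) : ℝ := m₁ (N⁻¹ • ξ)

/-- The smoothing operator I_N with Fourier multiplier m_N. -/
def Iop {n : ℕ} (m₁ : Rn n → ℝ) (N : ℝ) (f : Rn n → ℂ) : Rn n → ℂ :=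
  fun x => 𝓕⁻ (fun ξ => (mN m₁ N ξ : ℂ) * 𝓕 f ξ) x

/-- The spatial multiplier ⟨∇⟩^s. -/
def japMul (n : ℕ) (s : ℝ) (f : Rn n → ℂ) : Rn n → ℂ :=
  fun x => 𝓕⁻ (fun ξ => ((jap ξ ^ s : ℝ) : ℂ) * 𝓕 f ξ) x

/-- Sharp Littlewood–Paley projection onto {M ≤ ⟨ξ⟩ ≤ 2M}. -/
def LP (n : ℕ) (M : ℝ) (f : Rn n → ℂ) : Rn n → ℂ :=
  fun x => 𝓕⁻ (fun ξ => if M ≤ jap ξ ∧ jap ξ ≤ 2 * M then 𝓕 f ξ else 0) x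

/-- Space-time Fourier transform ψ̃(ξ,τ). -/
def stFourier (n : ℕ) {E : Type*} [NormedAddCommGroup E] [NormedSpace ℂ E]
    (ψ : Rn n → ℝ → E) (ξ : Rn n) (τ : ℝ) : E :=
  ∫ x : Rn n, ∫ t : ℝ,
    Complex.exp (Complex.I * ((-2 * Real.pi * (⟪x, ξ⟫ + t * τ) : ℝ) : ℂ)) • ψ x t

/-- The X_{s,b} norm ‖⟨ξ⟩^s ⟨τ-|ξ|²⟩^b ψ̃‖_{L²}. -/
def XNorm (n : ℕ) {E : Type*} [NormedAddCommGroup E] [NormedSpace ℂ E]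
    (s b : ℝ) (ψ : Rn n → ℝ → E) : ℝ :=
  (∫ ξ : Rn n, ∫ τ : ℝ,
    jap ξ ^ (2 * s) * japR (τ - ‖ξ‖ ^ 2) ^ (2 * b) * ‖stFourier n ψ ξ τ‖ ^ 2) ^ (1/2 : ℝ)

/-- The restricted norm X^δ_{s,b}: infimum over Schwartz extensions off ℝⁿ × [0,δ]. -/
def XRNorm (n : ℕ) {E : Type*} [NormedAddCommGroup E] [NormedSpace ℂ E]
    (s b δ : ℝ) (f : Rn n → ℝ → E) : ℝ :=
  sInf { r : ℝ | ∃ ψ : SchwartzMap (Rn n × ℝ) E,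
    (∀ x : Rn n, ∀ t ∈ Icc (0:ℝ) δ, ψ (x, t) = f x t) ∧
    r = XNorm n s b (fun x t => ψ (x, t)) }

/-- Space-time L^p norm on ℝⁿ × ℝ. -/
def lpNormST (n : ℕ) {E : Type*} [NormedAddCommGroup E] (p : ℝ) (F : Rn n → ℝ → E) : ℝ :=
  (∫ t : ℝ, ∫ x : Rn n, ‖F x t‖ ^ p) ^ (1/p)

/-- Space-time L^p norm on ℝⁿ × [0,δ]. -/
def lpNormSTt (n : ℕ) {E : Type*} [NormedAddCommGroup E] (p δ : ℝ) (F : Rn n → ℝ → E) : ℝ :=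
  (∫ t in Icc (0:ℝ) δ, ∫ x : Rn n, ‖F x t‖ ^ p) ^ (1/p)

open scoped SchwartzMap LineDeriv

/-! ### The space-time Fourier transform on Schwartz functions -/

section SpaceTime

variable {n : ℕ}

/-- The `L²` product of space and time, as an inner product space. -/
abbrev SpTime (n : ℕ) := WithLp 2 (Rn n × ℝ)

/-- The identification of the `L²` product of space and time with the plain product. -/
def spTimeEquiv (n : ℕ) : SpTime n ≃L[ℝ] Rn n × ℝ :=
  WithLp.prodContinuousLinearEquiv 2 ℝ (Rn n) ℝ

/-- The space-time Fourier transform as a map on Schwartz functions. -/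
def stF (f : 𝓢(Rn n × ℝ, ℂ)) : 𝓢(Rn n × ℝ, ℂ) :=
  SchwartzMap.compCLMOfContinuousLinearEquiv ℂ (spTimeEquiv n).symm
    (𝓕 (SchwartzMap.compCLMOfContinuousLinearEquiv ℂ (spTimeEquiv n) f))

/-- The inverse space-time Fourier transform as a map on Schwartz functions. -/
def stFInv (f : 𝓢(Rn n × ℝ, ℂ)) : 𝓢(Rn n × ℝ, ℂ) :=
  SchwartzMap.compCLMOfContinuousLinearEquiv ℂ (spTimeEquiv n).symm
    (𝓕⁻ (SchwartzMap.compCLMOfContinuousLinearEquiv ℂ (spTimeEquiv n) f))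

lemma stFInv_stF (f : 𝓢(Rn n × ℝ, ℂ)) : stFInv (stF f) = f := by
  have h : ∀ g : 𝓢(SpTime n, ℂ), SchwartzMap.compCLMOfContinuousLinearEquiv ℂ (spTimeEquiv n)
      (SchwartzMap.compCLMOfContinuousLinearEquiv ℂ (spTimeEquiv n).symm g) = g := by
    intro g; ext x; simp
  unfold stFInv stF
  rw [h, FourierTransform.fourierInv_fourier_eq]
  ext x; simp

lemma stF_stFInv (f : 𝓢(Rn n × ℝ, ℂ)) : stF (stFInv f) = f := by
  have h : ∀ g : 𝓢(SpTime n, ℂ), SchwartzMap.compCLMOfContinuousLinearEquiv ℂ (spTimeEquiv n)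
      (SchwartzMap.compCLMOfContinuousLinearEquiv ℂ (spTimeEquiv n).symm g) = g := by
    intro g; ext x; simp
  unfold stFInv stF
  rw [h, FourierTransform.fourier_fourierInv_eq]
  ext x; simp

/-- The unimodular character `e^{2πir}`. -/
def ch (r : ℝ) : ℂ := Complex.exp ((2 * Real.pi * r : ℝ) * Complex.I)

@[simp] lemma norm_ch (r : ℝ) : ‖ch r‖ = 1 := Complex.norm_exp_ofReal_mul_I _

lemma ch_add (r s : ℝ) : ch (r + s) = ch r * ch s := by
  unfold ch; rw [← Complex.exp_add]; congr 1; push_cast; ring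

lemma conj_ch (r : ℝ) : (starRingEnd ℂ) (ch r) = ch (-r) := by
  unfold ch; rw [← Complex.exp_conj]; congr 1
  simp only [map_mul, Complex.conj_ofReal, Complex.conj_I]; push_cast; ring

@[fun_prop] lemma continuous_ch : Continuous ch := by unfold ch; fun_prop

@[fun_prop] lemma measurable_ch : Measurable ch := continuous_ch.measurable

lemma fourier_eq_ch {V : Type*} [NormedAddCommGroup V] [InnerProductSpace ℝ V]
    [FiniteDimensional ℝ V] [MeasurableSpace V] [BorelSpace V] (f : V → ℂ) (w : V) :
    𝓕 f w = ∫ v, ch (-⟪v, w⟫) * f v := by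
  rw [Real.fourier_eq']
  congr 1; ext v; simp [ch]

lemma fourierInv_eq_ch {V : Type*} [NormedAddCommGroup V] [InnerProductSpace ℝ V]
    [FiniteDimensional ℝ V] [MeasurableSpace V] [BorelSpace V] (f : V → ℂ) (w : V) :
    𝓕⁻ f w = ∫ v, ch ⟪v, w⟫ * f v := by
  rw [Real.fourierInv_eq']
  congr 1

lemma integral_spTime (g : Rn n × ℝ → ℂ) :
    ∫ w : SpTime n, g (spTimeEquiv n w) = ∫ p, g p := by
  rw [← (WithLp.volume_preserving_toLp (Rn n) ℝ).integral_comp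
    (MeasurableEquiv.toLp 2 (Rn n × ℝ)).measurableEmbedding]
  rfl

lemma integrable_ch_mul {α : Type*} [MeasurableSpace α] {μ : Measure α} {f : α → ℂ}
    (hf : Integrable f μ) {g : α → ℝ} (hg : AEStronglyMeasurable g μ) :
    Integrable (fun x => ch (g x) * f x) μ := by
  refine (hf.norm).mono' ((continuous_ch.comp_aestronglyMeasurable hg).mul hf.1) ?_
  filter_upwards with x; simp

instance : (volume : Measure (Rn n × ℝ)).HasTemperateGrowth := by
  have : (volume : Measure (Rn n × ℝ)).IsAddHaarMeasure := by
    rw [Measure.volume_eq_prod]; infer_instance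
  infer_instance

lemma stF_apply (f : 𝓢(Rn n × ℝ, ℂ)) (ξ : Rn n) (τ : ℝ) :
    stF f (ξ, τ) = ∫ p : Rn n × ℝ, ch (-(⟪p.1, ξ⟫ + p.2 * τ)) * f p := by
  rw [← integral_spTime]
  unfold stF
  simp only [SchwartzMap.compCLMOfContinuousLinearEquiv_apply, Function.comp_apply,
    SchwartzMap.fourier_coe]
  rw [fourier_eq_ch]
  congr 1; ext w
  simp [spTimeEquiv, mul_comm]

lemma stFInv_apply (f : 𝓢(Rn n × ℝ, ℂ)) (x : Rn n) (t : ℝ) :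
    stFInv f (x, t) = ∫ p : Rn n × ℝ, ch (⟪p.1, x⟫ + p.2 * t) * f p := by
  rw [← integral_spTime]
  unfold stFInv
  simp only [SchwartzMap.compCLMOfContinuousLinearEquiv_apply, Function.comp_apply,
    SchwartzMap.fourierInv_coe]
  rw [fourierInv_eq_ch]
  congr 1; ext w
  simp [spTimeEquiv, mul_comm]

lemma stFourier_eq_stF (f : 𝓢(Rn n × ℝ, ℂ)) (ξ : Rn n) (τ : ℝ) :
    stFourier n (fun x t => f (x, t)) ξ τ = stF f (ξ, τ) := by
  rw [stF_apply]
  have hi : Integrable (fun p : Rn n × ℝ => ch (-(⟪p.1, ξ⟫ + p.2 * τ)) * f p) :=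
    integrable_ch_mul f.integrable (by fun_prop)
  rw [Measure.volume_eq_prod, integral_prod _ hi]
  unfold stFourier
  congr 1; ext x; congr 1; ext t
  simp only [ch, smul_eq_mul]
  congr 2
  push_cast; ring

lemma stF_lineDeriv (f : 𝓢(Rn n × ℝ, ℂ)) (v : Rn n) (ξ : Rn n) (τ : ℝ) :
    stF (∂_{((v, 0) : Rn n × ℝ)} f) (ξ, τ) = 2 * Real.pi * Complex.I * ⟪ξ, v⟫ * stF f (ξ, τ) := by
  unfold stF
  have h := SchwartzMap.lineDerivOp_compCLMOfContinuousLinearEquiv (𝕜 := ℂ)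
    ((spTimeEquiv n).symm (v, 0)) (spTimeEquiv n) f
  rw [ContinuousLinearEquiv.apply_symm_apply] at h
  rw [← h, SchwartzMap.fourier_lineDerivOp_eq]
  have h2 : (fun x : SpTime n => inner ℝ x ((spTimeEquiv n).symm (v, 0))).HasTemperateGrowth := by
    fun_prop
  simp only [SchwartzMap.compCLMOfContinuousLinearEquiv_apply, Function.comp_apply,
    smul_apply, SchwartzMap.smulLeftCLM_apply_apply h2]
  simp [spTimeEquiv, mul_assoc]

end SpaceTime

/-! ### Temperate growth of admissible multipliers -/

lemma IsAdmissibleMultiplier.hasTemperateGrowth {n : ℕ} {s : ℝ} (hs : s ≤ 1) {m : Rn n → ℝ}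
    (hm : IsAdmissibleMultiplier n s m) : m.HasTemperateGrowth := by
  obtain ⟨hsm, -, -, -, -, hhom⟩ := hm
  refine ⟨hsm, fun k => ?_⟩
  have hcont : Continuous (iteratedFDeriv ℝ k m) :=
    hsm.continuous_iteratedFDeriv (mod_cast le_top)
  obtain ⟨C, hC⟩ := (isCompact_closedBall (0 : Rn n) 3).exists_bound_of_continuousOn
    hcont.continuousOn
  refine ⟨0, C, fun x => ?_⟩
  simp only [pow_zero, mul_one]
  rcases le_or_gt ‖x‖ 3 with hx | hx
  · exact hC x (by simpa using hx)
  set a : ℝ := ‖x‖ / 3 with ha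
  have ha1 : 1 ≤ a := by rw [ha, le_div_iff₀ (by norm_num)]; linarith
  have ha0 : 0 < a := by linarith
  set y : Rn n := a⁻¹ • x with hy
  have hay : a • y = x := by rw [hy, smul_smul, mul_inv_cancel₀ ha0.ne', one_smul]
  have hyn : ‖y‖ = 3 := by
    rw [hy, norm_smul, norm_inv, Real.norm_of_nonneg ha0.le, ha]
    field_simp
  have hev : (fun z => m (a • z)) =ᶠ[nhds y] fun z => (a ^ (-(1 - s))) • m z := by
    have : ∀ᶠ z in nhds y, 2 < ‖z‖ :=
      continuous_norm.continuousAt.eventually (lt_mem_nhds (by simp only [hyn]; norm_num))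
    filter_upwards [this] with z hz
    have haz : ‖a • z‖ = a * ‖z‖ := by rw [norm_smul, Real.norm_of_nonneg ha0.le]
    rw [hhom z hz.le, hhom (a • z) (by rw [haz]; nlinarith), haz,
      Real.mul_rpow ha0.le (norm_nonneg _), smul_eq_mul]
  have h1 := hev.iteratedFDeriv ℝ k |>.eq_of_nhds
  have hsk : ContDiff ℝ k m := hsm.of_le (mod_cast le_top)
  rw [iteratedFDeriv_comp_const_smul a hsk, iteratedFDeriv_const_smul_apply' hsk.contDiffAt] at h1
  simp only [hay] at h1
  have h2 := congrArg norm h1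
  rw [norm_smul, norm_smul, Real.norm_of_nonneg (by positivity),
    Real.norm_of_nonneg (by positivity)] at h2
  have h3 : a ^ (-(1 - s)) ≤ 1 := Real.rpow_le_one_of_one_le_of_nonpos ha1 (by linarith)
  have h4 : 1 ≤ a ^ k := one_le_pow₀ ha1
  calc ‖iteratedFDeriv ℝ k m x‖ ≤ a ^ k * ‖iteratedFDeriv ℝ k m x‖ :=
        le_mul_of_one_le_left (norm_nonneg _) h4
    _ = a ^ (-(1 - s)) * ‖iteratedFDeriv ℝ k m y‖ := h2
    _ ≤ 1 * C := by
        gcongr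
        exact hC y (by simp [hyn])
    _ = C := one_mul C

/-! ### Partial Fourier transforms -/

section Partial

variable {n : ℕ}

/-- Inverse Fourier transform in the time variable only. -/
def timeFInv (h : 𝓢(Rn n × ℝ, ℂ)) (ξ : Rn n) (t : ℝ) : ℂ := ∫ τ : ℝ, ch (τ * t) * h (ξ, τ)

lemma SchwartzMap.exists_decay_snd (h : 𝓢(Rn n × ℝ, ℂ)) :
    ∃ C : ℝ, ∀ ξ τ, ‖h (ξ, τ)‖ ≤ C * (1 + τ ^ 2)⁻¹ := by
  obtain ⟨C0, hC0⟩ := h.decay 0 0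
  obtain ⟨C2, hC2⟩ := h.decay 2 0
  refine ⟨C0 + C2, fun ξ τ => ?_⟩
  have h0 := hC0.2 (ξ, τ)
  have h2 := hC2.2 (ξ, τ)
  simp only [pow_zero, one_mul, norm_iteratedFDeriv_zero] at h0 h2
  rw [← div_eq_mul_inv, le_div_iff₀ (by positivity)]
  have hτ : τ ^ 2 ≤ ‖(ξ, τ)‖ ^ 2 := by
    rw [← sq_abs τ]; gcongr; exact norm_snd_le (ξ, τ)
  nlinarith [norm_nonneg (h (ξ, τ)), mul_le_mul_of_nonneg_right hτ (norm_nonneg (h (ξ, τ)))]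

lemma continuous_timeFInv (h : 𝓢(Rn n × ℝ, ℂ)) (t : ℝ) : Continuous fun ξ => timeFInv h ξ t := by
  obtain ⟨C, hC⟩ := SchwartzMap.exists_decay_snd h
  refine continuous_of_dominated (bound := fun τ => C * (1 + τ ^ 2)⁻¹) ?_ ?_
    (integrable_inv_one_add_sq.const_mul C) ?_
  · intro ξ
    exact ((by fun_prop : Continuous fun τ : ℝ => ch (τ * t)).mul
      (h.continuous.comp (by fun_prop))).aestronglyMeasurable
  · intro ξ; filter_upwards with τ; simpa using hC ξ τ
  · filter_upwards with τ
    exact continuous_const.mul (h.continuous.comp (by fun_prop))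

lemma stFInv_eq_fourierInv (h : 𝓢(Rn n × ℝ, ℂ)) (x : Rn n) (t : ℝ) :
    stFInv h (x, t) = 𝓕⁻ (fun ξ => timeFInv h ξ t) x := by
  have hi : Integrable (fun p : Rn n × ℝ => ch (⟪p.1, x⟫ + p.2 * t) * h p) :=
    integrable_ch_mul h.integrable (by fun_prop)
  rw [stFInv_apply, fourierInv_eq_ch, Measure.volume_eq_prod, integral_prod _ hi]
  congr 1; ext ξ
  unfold timeFInv
  rw [← integral_const_mul]
  congr 1; ext τ
  rw [ch_add]; ring

lemma integrable_timeFInv (h : 𝓢(Rn n × ℝ, ℂ)) (t : ℝ) : Integrable fun ξ => timeFInv h ξ t := by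
  have hi : Integrable (fun p : Rn n × ℝ => ch (p.2 * t) * h p) :=
    integrable_ch_mul h.integrable (by fun_prop)
  exact hi.integral_prod_left

/-- The restriction of a Schwartz function to a time slice. -/
def timeSlice (f : 𝓢(Rn n × ℝ, ℂ)) (t : ℝ) : 𝓢(Rn n, ℂ) :=
  SchwartzMap.compCLMOfAntilipschitz ℂ (K := 1) (g := fun x : Rn n => (x, t))
    (by
      have h1 := (ContinuousLinearMap.inl ℝ (Rn n) ℝ).hasTemperateGrowth
      have h2 := Function.HasTemperateGrowth.const (E := Rn n) ((0, t) : Rn n × ℝ)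
      convert h1.add h2 using 1
      ext x <;> simp)
    (by
      intro x y
      simp [Prod.edist_eq]) f

@[simp] lemma timeSlice_apply (f : 𝓢(Rn n × ℝ, ℂ)) (t : ℝ) (x : Rn n) :
    timeSlice f t x = f (x, t) := rfl

lemma fourier_timeSlice (f : 𝓢(Rn n × ℝ, ℂ)) (t : ℝ) (ξ : Rn n) :
    𝓕 (fun x => f (x, t)) ξ = timeFInv (stF f) ξ t := by
  have h1 : (fun x => f (x, t)) = 𝓕⁻ (fun ξ => timeFInv (stF f) ξ t) := by
    ext x; rw [← stFInv_eq_fourierInv, stFInv_stF]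
  have h2 : Integrable (fun x => f (x, t)) := (timeSlice f t).integrable
  rw [h1] at h2 ⊢
  have h3 : Integrable (𝓕 fun ξ => timeFInv (stF f) ξ t) := by
    refine h2.comp_neg.congr (Filter.Eventually.of_forall fun ξ => ?_)
    simp [Real.fourierInv_eq_fourier_neg]
  rw [Continuous.fourier_fourierInv_eq (continuous_timeFInv _ t) (integrable_timeFInv _ t) h3]

end Partial

/-! ### The smoothed gradient and its `X_{0,b}` norm -/

section Smoothing

variable {n : ℕ}

lemma hasTemperateGrowth_fst_ofReal {m : Rn n → ℝ} (hm : m.HasTemperateGrowth) :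
    (fun p : Rn n × ℝ => (m p.1 : ℂ)).HasTemperateGrowth :=
  Function.HasTemperateGrowth.comp Function.Complex.hasTemperateGrowth_ofReal
    (hm.comp (ContinuousLinearMap.fst ℝ (Rn n) ℝ).hasTemperateGrowth)

/-- The space-time Schwartz function `I φ`. -/
def smoothed (m : Rn n → ℝ) (φ : 𝓢(Rn n × ℝ, ℂ)) : 𝓢(Rn n × ℝ, ℂ) :=
  stFInv (SchwartzMap.smulLeftCLM ℂ (fun p : Rn n × ℝ => (m p.1 : ℂ)) (stF φ))

/-- The `i`-th spatial derivative of `I φ`, as a space-time Schwartz function. -/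
def gradSmoothed (m : Rn n → ℝ) (φ : 𝓢(Rn n × ℝ, ℂ)) (i : Fin n) : 𝓢(Rn n × ℝ, ℂ) :=
  ∂_{((EuclideanSpace.single i 1, 0) : Rn n × ℝ)} (smoothed m φ)

lemma Iop_eq_smoothed {m : Rn n → ℝ} (hm : m.HasTemperateGrowth) (φ : 𝓢(Rn n × ℝ, ℂ))
    (x : Rn n) (t : ℝ) : Iop m 1 (fun y => φ (y, t)) x = smoothed m φ (x, t) := by
  unfold Iop smoothed
  rw [stFInv_eq_fourierInv]
  refine congrFun (congrArg _ (funext fun ξ => ?_)) x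
  rw [fourier_timeSlice]
  unfold timeFInv
  rw [← integral_const_mul]
  refine integral_congr_ae (Filter.Eventually.of_forall fun τ => ?_)
  simp only
  rw [SchwartzMap.smulLeftCLM_apply_apply (hasTemperateGrowth_fst_ofReal hm)]
  simp [mN]; ring

lemma gradC_Iop_apply {m : Rn n → ℝ} (hm : m.HasTemperateGrowth) (φ : 𝓢(Rn n × ℝ, ℂ))
    (x : Rn n) (t : ℝ) (i : Fin n) :
    gradC (Iop m 1 (fun y => φ (y, t))) x i = gradSmoothed m φ i (x, t) := by
  have h : Iop m 1 (fun y => φ (y, t)) = fun y => smoothed m φ (y, t) := by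
    ext y; exact Iop_eq_smoothed hm φ y t
  have h1 : gradC (Iop m 1 (fun y => φ (y, t))) x i
      = fderiv ℝ (fun y => smoothed m φ (y, t)) x (EuclideanSpace.single i 1) := by
    rw [h]; rfl
  rw [h1]
  unfold gradSmoothed
  rw [SchwartzMap.lineDerivOp_apply_eq_fderiv]
  have h2 : HasFDerivAt (fun y : Rn n => (y, t)) (ContinuousLinearMap.inl ℝ (Rn n) ℝ) x :=
    hasFDerivAt_prodMk_left x t
  have h3 := ((smoothed m φ).hasFDerivAt (x, t)).comp x h2
  have h4 : fderiv ℝ (fun y => smoothed m φ (y, t)) x = _ := h3.fderiv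
  rw [h4]; rfl

lemma stF_gradSmoothed {m : Rn n → ℝ} (hm : m.HasTemperateGrowth) (φ : 𝓢(Rn n × ℝ, ℂ))
    (i : Fin n) (ξ : Rn n) (τ : ℝ) :
    stF (gradSmoothed m φ i) (ξ, τ)
      = 2 * Real.pi * Complex.I * (ξ i : ℝ) * ((m ξ : ℝ) * stF φ (ξ, τ)) := by
  unfold gradSmoothed smoothed
  rw [stF_lineDeriv, stF_stFInv,
    SchwartzMap.smulLeftCLM_apply_apply (hasTemperateGrowth_fst_ofReal hm)]
  simp [EuclideanSpace.inner_single_right]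

lemma stFourier_apply_comp {ι : Type*} [Fintype ι] (F : ι → 𝓢(Rn n × ℝ, ℂ))
    (v : Rn n → ℝ → EuclideanSpace ℂ ι) (hv : ∀ x t i, v x t i = F i (x, t))
    (ξ : Rn n) (τ : ℝ) (i : ι) : stFourier n v ξ τ i = stF (F i) (ξ, τ) := by
  have hc : ∀ i x t, (Complex.exp (Complex.I * ((-2 * Real.pi * (⟪x, ξ⟫ + t * τ) : ℝ) : ℂ)) •
      v x t) i = ch (-(⟪x, ξ⟫ + t * τ)) * F i (x, t) := by
    intro i x t
    simp only [PiLp.smul_apply, hv, ch, smul_eq_mul]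
    congr 2; push_cast; ring
  have hI : ∀ i, Integrable (fun p : Rn n × ℝ => ch (-(⟪p.1, ξ⟫ + p.2 * τ)) * F i p)
      ((volume : Measure (Rn n)).prod volume) := fun i => by
    rw [← Measure.volume_eq_prod]
    exact integrable_ch_mul (F i).integrable (by fun_prop)
  have hp : Integrable (fun p : Rn n × ℝ =>
      Complex.exp (Complex.I * ((-2 * Real.pi * (⟪p.1, ξ⟫ + p.2 * τ) : ℝ) : ℂ)) • v p.1 p.2)
      ((volume : Measure (Rn n)).prod volume) := by
    refine Integrable.of_eval_piLp fun i => ?_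
    simp only [hc]
    exact hI i
  rw [← stFourier_eq_stF]
  have e1 : stFourier n v ξ τ = ∫ p : Rn n × ℝ,
      Complex.exp (Complex.I * ((-2 * Real.pi * (⟪p.1, ξ⟫ + p.2 * τ) : ℝ) : ℂ)) • v p.1 p.2 := by
    rw [Measure.volume_eq_prod, integral_prod _ hp]; rfl
  rw [stFourier_eq_stF, stF_apply, e1, Measure.volume_eq_prod]
  rw [eval_integral_piLp (fun i => by simpa only [hc] using hI i)]
  simp only [hc]

lemma norm_sq_stFourier_gradC {m : Rn n → ℝ} (hm : m.HasTemperateGrowth)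
    (φ : 𝓢(Rn n × ℝ, ℂ)) (ξ : Rn n) (τ : ℝ) :
    ‖stFourier n (fun x t => gradC (Iop m 1 (fun y => φ (y, t))) x) ξ τ‖ ^ 2
      = ∑ i, ‖stF (gradSmoothed m φ i) (ξ, τ)‖ ^ 2 := by
  rw [EuclideanSpace.norm_sq_eq]
  refine Finset.sum_congr rfl fun i _ => ?_
  rw [stFourier_apply_comp (gradSmoothed m φ) _ (fun x t i => gradC_Iop_apply hm φ x t i)]

lemma sum_norm_sq_stF_gradSmoothed {m : Rn n → ℝ} (hm : m.HasTemperateGrowth)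
    (φ : 𝓢(Rn n × ℝ, ℂ)) (ξ : Rn n) (τ : ℝ) :
    ∑ i, ‖stF (gradSmoothed m φ i) (ξ, τ)‖ ^ 2
      = (2 * Real.pi * ‖ξ‖ * m ξ) ^ 2 * ‖stF φ (ξ, τ)‖ ^ 2 := by
  simp only [stF_gradSmoothed hm, norm_mul, mul_pow, EuclideanSpace.norm_sq_eq ξ,
    Complex.norm_real, Complex.norm_I, Complex.norm_ofNat, Real.norm_eq_abs, sq_abs,
    Finset.mul_sum, Finset.sum_mul, mul_one]
  exact Finset.sum_congr rfl fun i _ => by ring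

/-- The modulation weight `⟨τ - |ξ|²⟩^{2b}`. -/
def modWt (b : ℝ) (ξ : Rn n) (τ : ℝ) : ℝ := japR (τ - ‖ξ‖ ^ 2) ^ (2 * b)

lemma japR_pos (x : ℝ) : 0 < japR x := Real.sqrt_pos.2 (by positivity)

lemma modWt_pos (b : ℝ) (ξ : Rn n) (τ : ℝ) : 0 < modWt b ξ τ := Real.rpow_pos_of_pos (japR_pos _) _

lemma japR_rpow (b x : ℝ) : japR x ^ (2 * b) = (1 + x ^ 2) ^ b := by
  unfold japR
  rw [Real.sqrt_eq_rpow, ← Real.rpow_mul (by positivity)]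
  congr 1; ring

lemma hasTemperateGrowth_modWt (b : ℝ) :
    (fun p : Rn n × ℝ => modWt b p.1 p.2).HasTemperateGrowth := by
  have h1 : (fun x : ℝ => (1 + ‖x‖ ^ 2) ^ b).HasTemperateGrowth :=
    Function.hasTemperateGrowth_one_add_norm_sq_rpow (H := ℝ) b
  have h2 : (fun p : Rn n × ℝ => p.2 - ‖p.1‖ ^ 2).HasTemperateGrowth :=
    (ContinuousLinearMap.snd ℝ (Rn n) ℝ).hasTemperateGrowth.sub
      ((Function.hasTemperateGrowth_norm_sq (Rn n)).comp
        (ContinuousLinearMap.fst ℝ (Rn n) ℝ).hasTemperateGrowth)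
  convert h1.comp h2 using 1
  funext p
  simp [modWt, japR_rpow]

@[fun_prop] lemma continuous_modWt (b : ℝ) : Continuous fun p : Rn n × ℝ => modWt b p.1 p.2 :=
  (hasTemperateGrowth_modWt b).1.continuous

lemma integrable_modWt_mul_norm_sq (b : ℝ) (h : 𝓢(Rn n × ℝ, ℂ)) :
    Integrable fun p : Rn n × ℝ => modWt b p.1 p.2 * ‖h p‖ ^ 2 := by
  have h1 := (SchwartzMap.smulLeftCLM ℂ (fun p : Rn n × ℝ => modWt b p.1 p.2) h).integrable
    (μ := volume)
  obtain ⟨C, hC⟩ := h.decay 0 0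
  simp only [pow_zero, one_mul, norm_iteratedFDeriv_zero] at hC
  refine (h1.norm.mul_const C).mono' ?_ ?_
  · exact ((continuous_modWt b).mul (h.continuous.norm.pow 2)).aestronglyMeasurable
  · filter_upwards with p
    rw [SchwartzMap.smulLeftCLM_apply_apply (hasTemperateGrowth_modWt b), norm_smul, norm_mul,
      norm_pow, norm_norm, sq, ← mul_assoc]
    gcongr
    exact hC.2 p

/-- The square of the `X_{0,b}` norm of a Schwartz function, as an extended real. -/
def xSq (b : ℝ) (ψ : 𝓢(Rn n × ℝ, ℂ)) : ENNReal :=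
  ∫⁻ ξ : Rn n, ∫⁻ τ : ℝ, ENNReal.ofReal (modWt b ξ τ) * ‖stF ψ (ξ, τ)‖ₑ ^ 2

lemma ofReal_sq_XNorm_gradC {m : Rn n → ℝ} (hm : m.HasTemperateGrowth) (b : ℝ)
    (φ : 𝓢(Rn n × ℝ, ℂ)) :
    ENNReal.ofReal (XNorm n 0 b (fun x t => gradC (Iop m 1 (fun y => φ (y, t))) x)) ^ 2
      = ∫⁻ ξ : Rn n, ∫⁻ τ : ℝ, ENNReal.ofReal (modWt b ξ τ) *
          ∑ i, ‖stF (gradSmoothed m φ i) (ξ, τ)‖ₑ ^ 2 := by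
  set G : Rn n × ℝ → ℝ := fun p =>
    modWt b p.1 p.2 * ∑ i, ‖stF (gradSmoothed m φ i) p‖ ^ 2 with hG
  have hGi : Integrable G := by
    simp only [hG, Finset.mul_sum]
    exact integrable_finsetSum _ fun i _ => integrable_modWt_mul_norm_sq b _
  have hG0 : ∀ p, 0 ≤ G p := fun p =>
    mul_nonneg (modWt_pos _ _ _).le (Finset.sum_nonneg fun i _ => by positivity)
  have hGm : Measurable fun p => ENNReal.ofReal (G p) := by
    have : Continuous G := (continuous_modWt b).mul (continuous_finsetSum _ fun i _ =>
      ((stF (gradSmoothed m φ i)).continuous.norm.pow 2))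
    exact ENNReal.measurable_ofReal.comp this.measurable
  have hX : XNorm n 0 b (fun x t => gradC (Iop m 1 (fun y => φ (y, t))) x)
      = (∫ p, G p) ^ (1 / 2 : ℝ) := by
    unfold XNorm
    rw [Measure.volume_eq_prod, integral_prod _ (by rwa [← Measure.volume_eq_prod])]
    simp only [norm_sq_stFourier_gradC hm, hG, modWt, mul_zero, Real.rpow_zero, one_mul]
  have hI0 : 0 ≤ ∫ p, G p := integral_nonneg hG0
  rw [hX, ← ENNReal.ofReal_pow (by positivity), ← Real.rpow_natCast, ← Real.rpow_mul hI0]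
  norm_num
  rw [ofReal_integral_eq_lintegral_ofReal hGi (Filter.Eventually.of_forall hG0),
    Measure.volume_eq_prod, lintegral_prod _ hGm.aemeasurable]
  congr 1; ext ξ; congr 1; ext τ
  rw [hG, ENNReal.ofReal_mul (modWt_pos _ _ _).le,
    ENNReal.ofReal_sum_of_nonneg (fun i _ => by positivity)]
  congr 1
  refine Finset.sum_congr rfl fun i _ => ?_
  rw [ENNReal.ofReal_pow (norm_nonneg _), ofReal_norm]

lemma measurable_modWt_mul_stF (b : ℝ) (ψ : 𝓢(Rn n × ℝ, ℂ)) :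
    Measurable fun p : Rn n × ℝ => ENNReal.ofReal (modWt b p.1 p.2) * ‖stF ψ p‖ₑ ^ 2 :=
  (ENNReal.measurable_ofReal.comp (continuous_modWt b).measurable).mul
    ((stF ψ).continuous.measurable.enorm.pow_const 2)

lemma sum_xSq_gradSmoothed {m : Rn n → ℝ} (hm : m.HasTemperateGrowth) (b : ℝ)
    (φ : 𝓢(Rn n × ℝ, ℂ)) :
    ∑ i, xSq b (gradSmoothed m φ i)
      = ENNReal.ofReal (XNorm n 0 b (fun x t => gradC (Iop m 1 (fun y => φ (y, t))) x)) ^ 2 := by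
  rw [ofReal_sq_XNorm_gradC hm]
  unfold xSq
  rw [← lintegral_finsetSum _ fun i _ => (measurable_modWt_mul_stF b _).lintegral_prod_right']
  congr 1; ext ξ
  simp only [Finset.mul_sum]
  exact (lintegral_finsetSum _ fun i _ =>
    (measurable_modWt_mul_stF b _).comp measurable_prodMk_left).symm

end Smoothing

/-! ### Weighted Cauchy-Schwarz and the energy estimate -/

lemma sq_lintegral_mul_le {α : Type*} [MeasurableSpace α] {μ : Measure α}
    {f g w w' : α → ENNReal} (hf : Measurable f) (hg : Measurable g) (hw : Measurable w)
    (hw' : Measurable w') (h : ∀ x, f x ≠ 0 → 1 ≤ w x * w' x) :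
    (∫⁻ x, f x * g x ∂μ) ^ 2 ≤ (∫⁻ x, w x * f x ^ 2 ∂μ) * ∫⁻ x, w' x * g x ^ 2 ∂μ := by
  have h1 : ∫⁻ x, f x * g x ∂μ
      ≤ ∫⁻ x, (w x * f x ^ 2) ^ (1 / 2 : ℝ) * (w' x * g x ^ 2) ^ (1 / 2 : ℝ) ∂μ := by
    refine lintegral_mono fun x => ?_
    rcases eq_or_ne (f x) 0 with hx | hx
    · simp [hx]
    rw [← ENNReal.mul_rpow_of_nonneg _ _ (by norm_num),
      show w x * f x ^ 2 * (w' x * g x ^ 2) = (w x * w' x) * (f x * g x) ^ 2 by ring,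
      ENNReal.mul_rpow_of_nonneg _ _ (by norm_num), ← ENNReal.rpow_natCast, ← ENNReal.rpow_mul]
    norm_num
    refine le_mul_of_one_le_left (zero_le) ?_
    exact ENNReal.one_le_rpow (h x hx) (by norm_num)
  have h2 := h1.trans (ENNReal.lintegral_mul_norm_pow_le (hw.mul (hf.pow_const 2)).aemeasurable
    (hw'.mul (hg.pow_const 2)).aemeasurable (by norm_num) (by norm_num) (by norm_num))
  calc (∫⁻ x, f x * g x ∂μ) ^ 2 ≤ _ := pow_le_pow_left' h2 2
    _ = _ := by
      rw [mul_pow, ← ENNReal.rpow_natCast, ← ENNReal.rpow_natCast, ← ENNReal.rpow_mul,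
        ← ENNReal.rpow_mul]
      norm_num

/-- The constant `∫ ⟨σ⟩^{-2b} dσ`. -/
def modConst (b : ℝ) : ENNReal := ∫⁻ σ : ℝ, ENNReal.ofReal (japR σ ^ (2 * -b))

lemma modConst_lt_top {b : ℝ} (hb : 1 / 2 < b) : modConst b < ⊤ := by
  have h := integrable_rpow_neg_one_add_norm_sq (E := ℝ) (μ := volume) (r := 2 * b)
    (by simp; linarith)
  have h2 : Integrable fun σ : ℝ => japR σ ^ (2 * -b) := by
    refine h.congr (Filter.Eventually.of_forall fun σ => ?_)
    simp only [japR_rpow, Real.norm_eq_abs, sq_abs]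
    congr 1; ring
  have h3 := h2.lintegral_lt_top
  exact h3

section Energy

variable {n : ℕ}

lemma lintegral_modWt_neg (b : ℝ) (ξ : Rn n) :
    ∫⁻ τ : ℝ, ENNReal.ofReal (modWt (-b) ξ τ) = modConst b :=
  lintegral_sub_right_eq_self (fun σ : ℝ => ENNReal.ofReal (japR σ ^ (2 * -b))) (‖ξ‖ ^ 2)

lemma modWt_mul_neg (b : ℝ) (ξ : Rn n) (τ : ℝ) : modWt b ξ τ * modWt (-b) ξ τ = 1 := by
  unfold modWt
  rw [← Real.rpow_add (japR_pos _)]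
  simp

lemma ofReal_modWt_mul_neg (b : ℝ) (ξ : Rn n) (τ : ℝ) :
    ENNReal.ofReal (modWt b ξ τ) * ENNReal.ofReal (modWt (-b) ξ τ) = 1 := by
  rw [← ENNReal.ofReal_mul (modWt_pos _ _ _).le, modWt_mul_neg, ENNReal.ofReal_one]

lemma measurable_ofReal_modWt (b : ℝ) :
    Measurable fun p : Rn n × ℝ => ENNReal.ofReal (modWt b p.1 p.2) :=
  ENNReal.measurable_ofReal.comp (continuous_modWt b).measurable

lemma measurable_ofReal_modWt_right (b : ℝ) (ξ : Rn n) :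
    Measurable fun τ : ℝ => ENNReal.ofReal (modWt b ξ τ) := by
  have : Continuous fun τ : ℝ => modWt b ξ τ :=
    (continuous_modWt b).comp (Continuous.prodMk_right ξ)
  exact this.measurable.ennreal_ofReal

lemma enorm_sq_timeFInv_le (b : ℝ) (h : 𝓢(Rn n × ℝ, ℂ)) (ξ : Rn n) (t : ℝ) :
    ‖timeFInv h ξ t‖ₑ ^ 2
      ≤ modConst b * ∫⁻ τ : ℝ, ENNReal.ofReal (modWt b ξ τ) * ‖h (ξ, τ)‖ₑ ^ 2 := by
  have h1 : ‖timeFInv h ξ t‖ₑ ≤ ∫⁻ τ : ℝ, ‖h (ξ, τ)‖ₑ * 1 := by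
    refine (enorm_integral_le_lintegral_enorm _).trans_eq ?_
    congr 1; ext τ
    rw [enorm_mul, ← ofReal_norm (ch _), norm_ch]; simp
  have m0 : Measurable fun τ : ℝ => ‖h (ξ, τ)‖ₑ :=
    (h.continuous.measurable.comp (measurable_prodMk_left (x := ξ))).enorm
  have h2 := sq_lintegral_mul_le (μ := (volume : Measure ℝ)) (f := fun τ : ℝ => ‖h (ξ, τ)‖ₑ)
    (g := fun _ => 1) m0 measurable_const 
    (measurable_ofReal_modWt_right b ξ) (measurable_ofReal_modWt_right (-b) ξ)
    (fun τ _ => (ofReal_modWt_mul_neg b ξ τ).ge)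
  simp only [one_pow, mul_one, lintegral_modWt_neg] at h1 h2
  rw [mul_comm]
  exact (pow_le_pow_left' h1 2).trans h2

lemma lintegral_enorm_sq_fourier (f : 𝓢(Rn n, ℂ)) :
    ∫⁻ ξ, ‖𝓕 (f : Rn n → ℂ) ξ‖ₑ ^ 2 = ∫⁻ x, ‖f x‖ₑ ^ 2 := by
  have key : ∀ g : 𝓢(Rn n, ℂ), ENNReal.ofReal (∫ x, ‖g x‖ ^ 2) = ∫⁻ x, ‖g x‖ₑ ^ 2 := by
    intro g
    have hi : Integrable (fun x => ‖g x‖ ^ 2) volume := by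
      simpa using (g.memLp 2 volume).integrable_norm_pow (by norm_num)
    rw [ofReal_integral_eq_lintegral_ofReal hi
      (Filter.Eventually.of_forall fun x => by positivity)]
    congr 1; ext x
    rw [ENNReal.ofReal_pow (norm_nonneg _), ofReal_norm]
  rw [← key, ← SchwartzMap.integral_norm_sq_fourier, key]
  rfl

/-- The embedding of `X_{0,b}` into `L^∞_t L²_x` for Schwartz functions. -/
lemma lintegral_enorm_sq_slice_le (b : ℝ) (ψ : 𝓢(Rn n × ℝ, ℂ)) (t : ℝ) :
    ∫⁻ x, ‖ψ (x, t)‖ₑ ^ 2 ≤ modConst b * xSq b ψ := by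
  have h1 := lintegral_enorm_sq_fourier (timeSlice ψ t)
  have h2 : ∀ ξ, 𝓕 (timeSlice ψ t : Rn n → ℂ) ξ = timeFInv (stF ψ) ξ t := fun ξ =>
    fourier_timeSlice ψ t ξ
  simp only [h2, timeSlice_apply] at h1
  rw [← h1]
  refine (lintegral_mono fun ξ => enorm_sq_timeFInv_le b (stF ψ) ξ t).trans_eq ?_
  rw [lintegral_const_mul _ (measurable_modWt_mul_stF b ψ).lintegral_prod_right']
  rfl

end Energy

/-! ### The dispersive estimate for Gaussian-weighted oscillatory integrals -/

/-- The bound `|λ - 2iu|^{-3/2}` for the Gaussian-regularised Schrödinger kernel in `ℝ³`. -/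
def dispKer (l u : ℝ) : ℝ := (l ^ 2 + 4 * u ^ 2) ^ (-(3 / 4 : ℝ))

lemma norm_integral_gaussian_ch_le {l : ℝ} (hl : 0 < l) (u : ℝ) (w : Rn 3) :
    ‖∫ ξ : Rn 3, (Real.exp (-(Real.pi * l * ‖ξ‖ ^ 2)) : ℂ) * ch (⟪w, ξ⟫ + u * ‖ξ‖ ^ 2)‖
      ≤ dispKer l u := by
  set z : ℂ := l - 2 * u * Complex.I with hz
  have hzre : z.re = l := by simp [hz]
  have hzim : z.im = -(2 * u) := by simp [hz]
  have hz0 : z ≠ 0 := fun h => by rw [h] at hzre; simp at hzre; linarith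
  have hπ : (Real.pi : ℂ) ≠ 0 := by exact_mod_cast Real.pi_ne_zero
  set b : ℂ := Real.pi * z with hb
  have hbre : 0 < b.re := by
    rw [hb, Complex.re_ofReal_mul, hzre]; positivity
  have h1 : ∀ ξ : Rn 3, (Real.exp (-(Real.pi * l * ‖ξ‖ ^ 2)) : ℂ) * ch (⟪w, ξ⟫ + u * ‖ξ‖ ^ 2)
      = Complex.exp (-b * ‖ξ‖ ^ 2 + (2 * Real.pi * Complex.I) * ⟪w, ξ⟫) := by
    intro ξ
    unfold ch
    rw [Complex.ofReal_exp, ← Complex.exp_add]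
    congr 1
    rw [hb, hz]; push_cast; ring
  simp only [h1]
  rw [GaussianFourier.integral_cexp_neg_mul_sq_norm_add hbre, norm_mul]
  have h2 : (Real.pi : ℂ) / b = z⁻¹ := by
    rw [hb]; field_simp
  have hns : ‖z‖ ^ 2 = l ^ 2 + 4 * u ^ 2 := by
    rw [Complex.sq_norm, Complex.normSq_apply, hzre, hzim]; ring
  have h3 : ‖((Real.pi : ℂ) / b) ^ ((Module.finrank ℝ (Rn 3) : ℂ) / 2)‖ = dispKer l u := by
    rw [h2, Complex.norm_cpow_of_ne_zero (inv_ne_zero hz0)]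
    have e1 : ((Module.finrank ℝ (Rn 3) : ℂ) / 2) = ((3 / 2 : ℝ) : ℂ) := by simp
    rw [e1, Complex.ofReal_re, Complex.ofReal_im, mul_zero, Real.exp_zero, div_one, norm_inv,
      Real.inv_rpow (norm_nonneg _), ← Real.rpow_neg (norm_nonneg _), dispKer, ← hns,
      ← Real.rpow_natCast, ← Real.rpow_mul (norm_nonneg _)]
    norm_num
  have h4 : ‖Complex.exp ((2 * Real.pi * Complex.I) ^ 2 * ‖w‖ ^ 2 / (4 * b))‖ ≤ 1 := by
    have e : (2 * Real.pi * Complex.I) ^ 2 * ‖w‖ ^ 2 / (4 * b)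
        = ((-(Real.pi * ‖w‖ ^ 2) : ℝ) : ℂ) * z⁻¹ := by
      rw [hb, mul_pow, Complex.I_sq]
      field_simp
      push_cast; ring
    rw [Complex.norm_exp, Real.exp_le_one_iff, e, Complex.re_ofReal_mul, Complex.inv_re, hzre]
    have : 0 ≤ l / Complex.normSq z := div_nonneg hl.le (Complex.normSq_nonneg _)
    have h5 : 0 ≤ Real.pi * ‖w‖ ^ 2 := by positivity
    nlinarith [mul_nonneg h5 this]
  rw [h3]
  exact mul_le_of_le_one_right (Real.rpow_nonneg (by positivity) _) h4

/-- The extension operator dual to evaluation of free waves along a curve `y`. -/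
def curveExt (c : ℝ → ℂ) (y : ℝ → Rn 3) (ξ : Rn 3) : ℂ :=
  ∫ t, c t * ch (⟪y t, ξ⟫ + t * ‖ξ‖ ^ 2)

lemma measurable_phase {α : Type*} [MeasurableSpace α] {f g : α → Rn 3} {u : α → ℝ}
    (hf : Measurable f) (hg : Measurable g) (hu : Measurable u) :
    Measurable fun a => ch (⟪f a, g a⟫ + u a * ‖g a‖ ^ 2) := by
  have h1 : Measurable fun a => (⟪f a, g a⟫ : ℝ) := hf.inner hg
  exact measurable_ch.comp (h1.add (hu.mul (hg.norm.pow_const 2)))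

lemma integrable_gaussian_rn {l : ℝ} (hl : 0 < l) :
    Integrable fun ξ : Rn 3 => Real.exp (-(Real.pi * l * ‖ξ‖ ^ 2)) := by
  have h := GaussianFourier.integrable_cexp_neg_mul_sq_norm_add (V := Rn 3)
    (b := (Real.pi * l : ℝ)) (by rw [Complex.ofReal_re]; positivity) 0 0
  refine h.norm.congr (Filter.Eventually.of_forall fun ξ => ?_)
  simp only [Complex.norm_exp]
  congr 1
  simp only [zero_mul, add_zero]
  rw [← Complex.ofReal_neg, ← Complex.ofReal_pow, ← Complex.ofReal_mul, Complex.ofReal_re]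
  ring

lemma lintegral_gaussian_curveExt_le {c : ℝ → ℂ} (hc : Integrable c) {y : ℝ → Rn 3}
    (hy : Measurable y) {l : ℝ} (hl : 0 < l) :
    ∫⁻ ξ : Rn 3, ENNReal.ofReal (Real.exp (-(Real.pi * l * ‖ξ‖ ^ 2))) * ‖curveExt c y ξ‖ₑ ^ 2
      ≤ ∫⁻ p : ℝ × ℝ, ‖c p.1‖ₑ * ‖c p.2‖ₑ * ENNReal.ofReal (dispKer l (p.1 - p.2)) := by
  set g : Rn 3 → ℝ := fun ξ => Real.exp (-(Real.pi * l * ‖ξ‖ ^ 2)) with hg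
  have hgi : Integrable g := integrable_gaussian_rn hl
  have hgpos : ∀ ξ, 0 < g ξ := fun ξ => Real.exp_pos _
  set F : Rn 3 × (ℝ × ℝ) → ℂ := fun q => (g q.1 : ℂ) *
    ((c q.2.1 * (starRingEnd ℂ) (c q.2.2)) *
      (ch (⟪y q.2.1, q.1⟫ + q.2.1 * ‖q.1‖ ^ 2) *
        (starRingEnd ℂ) (ch (⟪y q.2.2, q.1⟫ + q.2.2 * ‖q.1‖ ^ 2)))) with hF
  have hcc : Integrable (fun p : ℝ × ℝ => c p.1 * (starRingEnd ℂ) (c p.2))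
      (volume.prod volume) := by
    refine hc.mul_prod (g := fun t => (starRingEnd ℂ) (c t)) ?_
    exact (Complex.conjLIE.toContinuousLinearEquiv.toContinuousLinearMap).integrable_comp hc
  have n1 : Measurable fun q : Rn 3 × (ℝ × ℝ) => q.1 := measurable_fst
  have n2 : Measurable fun q : Rn 3 × (ℝ × ℝ) => q.2.1 := measurable_fst.comp measurable_snd
  have n3 : Measurable fun q : Rn 3 × (ℝ × ℝ) => q.2.2 := measurable_snd.comp measurable_snd
  have hm1 : Measurable fun q : Rn 3 × (ℝ × ℝ) =>
      ch (⟪y q.2.1, q.1⟫ + q.2.1 * ‖q.1‖ ^ 2) := measurable_phase (hy.comp n2) n1 n2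
  have hm2 : Measurable fun q : Rn 3 × (ℝ × ℝ) =>
      (starRingEnd ℂ) (ch (⟪y q.2.2, q.1⟫ + q.2.2 * ‖q.1‖ ^ 2)) :=
    Complex.continuous_conj.measurable.comp (measurable_phase (hy.comp n3) n1 n3)
  have hFi : Integrable F (volume.prod (volume.prod volume)) := by
    have h0 := (hgi.ofReal (𝕜 := ℂ)).mul_prod hcc
    refine h0.norm.mono' ?_ ?_
    · have := h0.1.mul (hm1.mul hm2).aestronglyMeasurable
      refine this.congr (Filter.Eventually.of_forall fun q => ?_)
      exact mul_assoc _ _ _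
    · filter_upwards with q
      simp [hF]
  have hH : ∀ ξ, ((g ξ * ‖curveExt c y ξ‖ ^ 2 : ℝ) : ℂ) = ∫ p, F (ξ, p) := by
    intro ξ
    have e1 : ∀ p : ℝ × ℝ, F (ξ, p) = (g ξ : ℂ) * ((c p.1 * ch (⟪y p.1, ξ⟫ + p.1 * ‖ξ‖ ^ 2)) *
        (starRingEnd ℂ) (c p.2 * ch (⟪y p.2, ξ⟫ + p.2 * ‖ξ‖ ^ 2))) := by
      intro p; simp only [hF, map_mul]; ring
    simp only [e1]
    rw [integral_const_mul, Measure.volume_eq_prod,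
      integral_prod_mul (fun t => c t * ch (⟪y t, ξ⟫ + t * ‖ξ‖ ^ 2))
        (fun t => (starRingEnd ℂ) (c t * ch (⟪y t, ξ⟫ + t * ‖ξ‖ ^ 2))), integral_conj]
    change _ = (g ξ : ℂ) * (curveExt c y ξ * (starRingEnd ℂ) (curveExt c y ξ))
    rw [Complex.mul_conj, Complex.normSq_eq_norm_sq]
    push_cast; ring
  have hI : Integrable fun ξ => ((g ξ * ‖curveExt c y ξ‖ ^ 2 : ℝ) : ℂ) := by
    simp only [hH]; exact hFi.integral_prod_left
  have hI' : Integrable fun ξ => g ξ * ‖curveExt c y ξ‖ ^ 2 := by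
    have := hI.re
    simpa only [RCLike.re_to_complex, Complex.ofReal_re] using this
  have hL : ∫⁻ ξ, ENNReal.ofReal (g ξ) * ‖curveExt c y ξ‖ₑ ^ 2 = ‖∫ ξ, ∫ p, F (ξ, p)‖ₑ := by
    simp only [← hH]
    rw [integral_complex_ofReal, ← ofReal_norm, Complex.norm_real, Real.norm_of_nonneg
      (integral_nonneg fun ξ => mul_nonneg (hgpos ξ).le (by positivity)),
      ofReal_integral_eq_lintegral_ofReal hI'
      (Filter.Eventually.of_forall fun ξ => mul_nonneg (hgpos ξ).le (by positivity))]
    congr 1; ext ξ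
    rw [ENNReal.ofReal_mul (hgpos ξ).le, ENNReal.ofReal_pow (norm_nonneg _), ofReal_norm]
  rw [hL, Measure.volume_eq_prod, integral_integral_swap (f := fun ξ p => F (ξ, p)) hFi]
  refine (enorm_integral_le_lintegral_enorm _).trans (lintegral_mono fun p => ?_)
  have e2 : ∀ ξ, F (ξ, p) = (c p.1 * (starRingEnd ℂ) (c p.2)) * ((g ξ : ℂ) *
      ch (⟪y p.1 - y p.2, ξ⟫ + (p.1 - p.2) * ‖ξ‖ ^ 2)) := by
    intro ξ
    simp only [hF, conj_ch, ← ch_add]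
    rw [show ⟪y p.1, ξ⟫ + p.1 * ‖ξ‖ ^ 2 + -(⟪y p.2, ξ⟫ + p.2 * ‖ξ‖ ^ 2)
      = ⟪y p.1 - y p.2, ξ⟫ + (p.1 - p.2) * ‖ξ‖ ^ 2 by rw [inner_sub_left]; ring]
    ring
  simp only [e2]
  rw [integral_const_mul, enorm_mul, enorm_mul]
  have e3 : ‖(starRingEnd ℂ) (c p.2)‖ₑ = ‖c p.2‖ₑ := by
    rw [← ofReal_norm, ← ofReal_norm, RCLike.norm_conj]
  rw [e3]
  gcongr
  rw [← ofReal_norm]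
  exact ENNReal.ofReal_le_ofReal (norm_integral_gaussian_ch_le hl _ _)

/-! ### Fractional integration in time and the dual maximal estimate -/

/-- Young's inequality in the form needed for the bilinear form with a convolution kernel. -/
lemma lintegral_mul_mul_kernel_le {a k : ℝ → ENNReal} (ha : Measurable a) (hk : Measurable k) :
    ∫⁻ p : ℝ × ℝ, a p.1 * a p.2 * k (p.1 - p.2)
      ≤ (∫⁻ t, a t ^ (5 / 3 : ℝ)) ^ (6 / 5 : ℝ) * (∫⁻ t, k t ^ (5 / 4 : ℝ)) ^ (4 / 5 : ℝ) := by
  set A := ∫⁻ t, a t ^ (5 / 3 : ℝ) with hA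
  set K := ∫⁻ t, k t ^ (5 / 4 : ℝ) with hK
  have ha1 : Measurable fun p : ℝ × ℝ => a p.1 := ha.comp measurable_fst
  have ha2 : Measurable fun p : ℝ × ℝ => a p.2 := ha.comp measurable_snd
  have hk0 : Measurable fun p : ℝ × ℝ => k (p.1 - p.2) :=
    hk.comp (measurable_fst.sub measurable_snd)
  let f : Fin 3 → ℝ × ℝ → ENNReal := ![fun p => a p.1 ^ (5 / 3 : ℝ) * a p.2 ^ (5 / 3 : ℝ),
    fun p => a p.1 ^ (5 / 3 : ℝ) * k (p.1 - p.2) ^ (5 / 4 : ℝ),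
    fun p => a p.2 ^ (5 / 3 : ℝ) * k (p.1 - p.2) ^ (5 / 4 : ℝ)]
  have hf : ∀ i ∈ Finset.univ, AEMeasurable (f i) volume := by
    intro i _
    fin_cases i
    · exact ((ha1.pow_const _).mul (ha2.pow_const _)).aemeasurable
    · exact ((ha1.pow_const _).mul (hk0.pow_const _)).aemeasurable
    · exact ((ha2.pow_const _).mul (hk0.pow_const _)).aemeasurable
  have h := ENNReal.lintegral_prod_norm_pow_le Finset.univ hf
    (p := ![1 / 5, 2 / 5, 2 / 5]) (by simp [Fin.sum_univ_three]; norm_num)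
    (by intro i _; fin_cases i <;> norm_num)
  simp only [Fin.prod_univ_three] at h
  change ∫⁻ p : ℝ × ℝ, (a p.1 ^ (5 / 3 : ℝ) * a p.2 ^ (5 / 3 : ℝ)) ^ (1 / 5 : ℝ) *
      (a p.1 ^ (5 / 3 : ℝ) * k (p.1 - p.2) ^ (5 / 4 : ℝ)) ^ (2 / 5 : ℝ) *
      (a p.2 ^ (5 / 3 : ℝ) * k (p.1 - p.2) ^ (5 / 4 : ℝ)) ^ (2 / 5 : ℝ) ≤
    (∫⁻ p : ℝ × ℝ, a p.1 ^ (5 / 3 : ℝ) * a p.2 ^ (5 / 3 : ℝ)) ^ (1 / 5 : ℝ) *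
      (∫⁻ p : ℝ × ℝ, a p.1 ^ (5 / 3 : ℝ) * k (p.1 - p.2) ^ (5 / 4 : ℝ)) ^ (2 / 5 : ℝ) *
      (∫⁻ p : ℝ × ℝ, a p.2 ^ (5 / 3 : ℝ) * k (p.1 - p.2) ^ (5 / 4 : ℝ)) ^ (2 / 5 : ℝ) at h
  have i0 : ∫⁻ p : ℝ × ℝ, a p.1 ^ (5 / 3 : ℝ) * a p.2 ^ (5 / 3 : ℝ) = A * A := by
    rw [Measure.volume_eq_prod]
    exact lintegral_prod_mul (ha.pow_const _).aemeasurable (ha.pow_const _).aemeasurable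
  have i1 : ∫⁻ p : ℝ × ℝ, a p.1 ^ (5 / 3 : ℝ) * k (p.1 - p.2) ^ (5 / 4 : ℝ) = A * K := by
    have m : Measurable fun p : ℝ × ℝ => a p.1 ^ (5 / 3 : ℝ) * k (p.1 - p.2) ^ (5 / 4 : ℝ) :=
      (ha1.pow_const _).mul (hk0.pow_const _)
    rw [Measure.volume_eq_prod, lintegral_prod _ m.aemeasurable]
    have e : ∀ x, ∫⁻ y, a x ^ (5 / 3 : ℝ) * k (x - y) ^ (5 / 4 : ℝ) = a x ^ (5 / 3 : ℝ) * K := by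
      intro x
      have mk : Measurable fun u => k (x - u) ^ (5 / 4 : ℝ) :=
        (hk.comp (measurable_id.const_sub x)).pow_const _
      rw [lintegral_const_mul _ mk,
        lintegral_sub_left_eq_self (fun u => k u ^ (5 / 4 : ℝ)) x]
    simp only [e]
    rw [lintegral_mul_const _ (ha.pow_const _)]
  have i2 : ∫⁻ p : ℝ × ℝ, a p.2 ^ (5 / 3 : ℝ) * k (p.1 - p.2) ^ (5 / 4 : ℝ) = A * K := by
    have m : Measurable fun p : ℝ × ℝ => a p.2 ^ (5 / 3 : ℝ) * k (p.1 - p.2) ^ (5 / 4 : ℝ) :=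
      (ha2.pow_const _).mul (hk0.pow_const _)
    rw [Measure.volume_eq_prod, lintegral_prod_symm _ m.aemeasurable]
    have e : ∀ y, ∫⁻ x, a y ^ (5 / 3 : ℝ) * k (x - y) ^ (5 / 4 : ℝ) = a y ^ (5 / 3 : ℝ) * K := by
      intro y
      have mk : Measurable fun u => k (u - y) ^ (5 / 4 : ℝ) :=
        (hk.comp (measurable_id.sub_const y)).pow_const _
      rw [lintegral_const_mul _ mk,
        lintegral_sub_right_eq_self (fun u => k u ^ (5 / 4 : ℝ)) y]
    simp only [e]
    rw [lintegral_mul_const _ (ha.pow_const _)]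
  rw [i0, i1, i2] at h
  refine (le_of_eq ?_).trans (h.trans (le_of_eq ?_))
  · congr 1; ext p
    simp only [ENNReal.mul_rpow_of_nonneg _ _ (show (0 : ℝ) ≤ 1 / 5 by norm_num),
      ENNReal.mul_rpow_of_nonneg _ _ (show (0 : ℝ) ≤ 2 / 5 by norm_num), ← ENNReal.rpow_mul]
    have e : ∀ (x : ENNReal) (u v : ℝ), 0 ≤ u → 0 ≤ v → u + v = 1 → x ^ u * x ^ v = x := by
      intro x u v hu hv huv
      rw [← ENNReal.rpow_add_of_nonneg _ _ hu hv, huv, ENNReal.rpow_one]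
    calc a p.1 * a p.2 * k (p.1 - p.2)
        = (a p.1 ^ (5 / 3 * (1 / 5) : ℝ) * a p.1 ^ (5 / 3 * (2 / 5) : ℝ)) *
          (a p.2 ^ (5 / 3 * (1 / 5) : ℝ) * a p.2 ^ (5 / 3 * (2 / 5) : ℝ)) *
          (k (p.1 - p.2) ^ (5 / 4 * (2 / 5) : ℝ) * k (p.1 - p.2) ^ (5 / 4 * (2 / 5) : ℝ)) := by
          rw [e, e, e] <;> norm_num
      _ = _ := by ring
  · simp only [ENNReal.mul_rpow_of_nonneg _ _ (show (0 : ℝ) ≤ 1 / 5 by norm_num),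
      ENNReal.mul_rpow_of_nonneg _ _ (show (0 : ℝ) ≤ 2 / 5 by norm_num)]
    calc A ^ (1 / 5 : ℝ) * A ^ (1 / 5 : ℝ) * (A ^ (2 / 5 : ℝ) * K ^ (2 / 5 : ℝ)) *
          (A ^ (2 / 5 : ℝ) * K ^ (2 / 5 : ℝ))
        = (A ^ (1 / 5 : ℝ) * A ^ (1 / 5 : ℝ) * (A ^ (2 / 5 : ℝ) * A ^ (2 / 5 : ℝ))) *
          (K ^ (2 / 5 : ℝ) * K ^ (2 / 5 : ℝ)) := by ring
      _ = _ := by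
        simp only [← ENNReal.rpow_add_of_nonneg _ _ (show (0 : ℝ) ≤ 1 / 5 by norm_num)
            (show (0 : ℝ) ≤ 1 / 5 by norm_num),
          ← ENNReal.rpow_add_of_nonneg _ _ (show (0 : ℝ) ≤ 2 / 5 by norm_num)
            (show (0 : ℝ) ≤ 2 / 5 by norm_num)]
        rw [← ENNReal.rpow_add_of_nonneg _ _ (by norm_num) (by norm_num)]
        norm_num

/-- The `L^{5/4}` norm of the kernel `dispKer 1`, up to scaling. -/
def dispConst : ENNReal :=
  (∫⁻ s : ℝ, ENNReal.ofReal ((1 + s ^ 2) ^ (-(15 / 16) : ℝ))) ^ (4 / 5 : ℝ)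

lemma dispConst_lt_top : dispConst < ⊤ := by
  refine ENNReal.rpow_lt_top_of_nonneg (by norm_num) (ne_of_lt ?_)
  have h := integrable_rpow_neg_one_add_norm_sq (E := ℝ) (μ := volume) (r := 15 / 8)
    (by simp; norm_num)
  have h2 := h.lintegral_lt_top
  convert h2 using 6
  · simp
  · norm_num

lemma lintegral_comp_mul_left {a : ℝ} (ha : a ≠ 0) {f : ℝ → ENNReal} (hf : Measurable f) :
    ∫⁻ x, f (a * x) = ENNReal.ofReal |a⁻¹| * ∫⁻ x, f x := by
  rw [← lintegral_map hf (measurable_const_mul a), Real.map_volume_mul_left ha,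
    lintegral_smul_measure, smul_eq_mul]

lemma measurable_dispKer (l : ℝ) : Measurable (dispKer l) := by
  unfold dispKer; fun_prop

lemma lintegral_dispKer_rpow_le {l : ℝ} (hl : 0 < l) :
    (∫⁻ t, ENNReal.ofReal (dispKer l t) ^ (5 / 4 : ℝ)) ^ (4 / 5 : ℝ)
      ≤ ENNReal.ofReal (l ^ (-(7 / 10) : ℝ)) * dispConst := by
  have hm : Measurable fun s : ℝ => ENNReal.ofReal ((1 + s ^ 2) ^ (-(15 / 16) : ℝ)) := by
    fun_prop
  have e : ∀ t, ENNReal.ofReal (dispKer l t) ^ (5 / 4 : ℝ)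
      = ENNReal.ofReal (l ^ (-(15 / 8) : ℝ)) *
        ENNReal.ofReal ((1 + (2 / l * t) ^ 2) ^ (-(15 / 16) : ℝ)) := by
    intro t
    unfold dispKer
    rw [ENNReal.ofReal_rpow_of_nonneg (by positivity) (by norm_num),
      ← ENNReal.ofReal_mul (by positivity), ← Real.rpow_mul (by positivity),
      show l ^ 2 + 4 * t ^ 2 = l ^ 2 * (1 + (2 / l * t) ^ 2) by
        field_simp; ring,
      Real.mul_rpow (by positivity) (by positivity), ← Real.rpow_natCast l 2,
      ← Real.rpow_mul hl.le]
    norm_num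
  simp only [e]
  rw [lintegral_const_mul _ (by fun_prop), lintegral_comp_mul_left (by positivity) hm,
    ← mul_assoc, ← ENNReal.ofReal_mul (by positivity), ENNReal.mul_rpow_of_nonneg _ _ (by norm_num),
    ENNReal.ofReal_rpow_of_nonneg (by positivity) (by norm_num), dispConst]
  gcongr
  have h1 : l ^ (-(15 / 8) : ℝ) * |(2 / l)⁻¹| ≤ l ^ (-(7 / 8) : ℝ) := by
    rw [abs_of_pos (by positivity), inv_div]
    have : l ^ (-(7 / 8) : ℝ) = l ^ (-(15 / 8) : ℝ) * l := by
      rw [← Real.rpow_add_one hl.ne']; norm_num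
    rw [this]
    gcongr
    linarith
  calc (l ^ (-(15 / 8) : ℝ) * |(2 / l)⁻¹|) ^ (4 / 5 : ℝ)
      ≤ (l ^ (-(7 / 8) : ℝ)) ^ (4 / 5 : ℝ) := by gcongr
    _ = _ := by rw [← Real.rpow_mul hl.le]; norm_num

lemma lintegral_gaussian_curveExt_le_rpow {c : ℝ → ℂ} (hc : Integrable c) (hcm : Measurable c)
    {y : ℝ → Rn 3} (hy : Measurable y) {l : ℝ} (hl : 0 < l) :
    ∫⁻ ξ : Rn 3, ENNReal.ofReal (Real.exp (-(Real.pi * l * ‖ξ‖ ^ 2))) * ‖curveExt c y ξ‖ₑ ^ 2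
      ≤ ENNReal.ofReal (l ^ (-(7 / 10) : ℝ)) *
        (dispConst * (∫⁻ t, ‖c t‖ₑ ^ (5 / 3 : ℝ)) ^ (6 / 5 : ℝ)) := by
  refine (lintegral_gaussian_curveExt_le hc hy hl).trans ?_
  refine (lintegral_mul_mul_kernel_le (a := fun t => ‖c t‖ₑ)
    (k := fun u => ENNReal.ofReal (dispKer l u)) hcm.enorm
    (measurable_dispKer l).ennreal_ofReal).trans ?_
  rw [mul_comm, ← mul_assoc]
  gcongr
  exact lintegral_dispKer_rpow_le hl

/-- A weight comparable to `|ξ|^{-3/2}` at high frequency, written as a superposition of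
Gaussians. -/
def lowWt (ξ : Rn 3) : ENNReal := ∫⁻ l in Ioc (0 : ℝ) 1,
  ENNReal.ofReal (l ^ (-(1 / 4) : ℝ)) * ENNReal.ofReal (Real.exp (-(Real.pi * l * ‖ξ‖ ^ 2)))

lemma measurable_lowWt_integrand : Measurable fun q : Rn 3 × ℝ =>
    ENNReal.ofReal (q.2 ^ (-(1 / 4) : ℝ)) *
      ENNReal.ofReal (Real.exp (-(Real.pi * q.2 * ‖q.1‖ ^ 2))) := by
  fun_prop

lemma measurable_lowWt : Measurable lowWt :=
  measurable_lowWt_integrand.lintegral_prod_right'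

/-- The constant in the lower bound for `lowWt`. -/
def lowConst : ℝ := 4 ^ (-(3 / 4) : ℝ) * Real.exp (-(Real.pi / 4))

lemma lowConst_pos : 0 < lowConst := by unfold lowConst; positivity

lemma le_lowWt {ξ : Rn 3} (hξ : 1 / 2 ≤ ‖ξ‖) :
    ENNReal.ofReal (lowConst * ‖ξ‖ ^ (-(3 / 2) : ℝ)) ≤ lowWt ξ := by
  have hpos : 0 < ‖ξ‖ := by linarith
  set a : ℝ := (4 * ‖ξ‖ ^ 2)⁻¹ with ha
  have ha0 : 0 < a := by positivity
  have ha1 : a ≤ 1 := by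
    refine inv_le_one_of_one_le₀ ?_
    nlinarith
  have h1 : lowConst * ‖ξ‖ ^ (-(3 / 2) : ℝ)
      = a ^ (-(1 / 4) : ℝ) * Real.exp (-(Real.pi / 4)) * a := by
    have : a ^ (-(1 / 4) : ℝ) * a = 4 ^ (-(3 / 4) : ℝ) * ‖ξ‖ ^ (-(3 / 2) : ℝ) := by
      rw [← Real.rpow_add_one ha0.ne', ha, Real.inv_rpow (by positivity),
        ← Real.rpow_neg (by positivity), Real.mul_rpow (by norm_num) (by positivity),
        ← Real.rpow_natCast ‖ξ‖ 2, ← Real.rpow_mul hpos.le]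
      norm_num
    rw [mul_right_comm, this, lowConst]; ring
  rw [h1]
  calc ENNReal.ofReal (a ^ (-(1 / 4) : ℝ) * Real.exp (-(Real.pi / 4)) * a)
      = ∫⁻ _ in Ioc (0 : ℝ) a, ENNReal.ofReal (a ^ (-(1 / 4) : ℝ)) *
          ENNReal.ofReal (Real.exp (-(Real.pi / 4))) := by
        rw [setLIntegral_const, Real.volume_Ioc, sub_zero, ENNReal.ofReal_mul (by positivity),
          ENNReal.ofReal_mul (by positivity)]
    _ ≤ ∫⁻ l in Ioc (0 : ℝ) a, ENNReal.ofReal (l ^ (-(1 / 4) : ℝ)) *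
          ENNReal.ofReal (Real.exp (-(Real.pi * l * ‖ξ‖ ^ 2))) := by
        refine setLIntegral_mono' measurableSet_Ioc fun l hl => ?_
        refine mul_le_mul' (ENNReal.ofReal_le_ofReal ?_) (ENNReal.ofReal_le_ofReal ?_)
        · exact Real.rpow_le_rpow_of_nonpos hl.1 hl.2 (by norm_num)
        · refine Real.exp_le_exp.2 (neg_le_neg ?_)
          have : l * ‖ξ‖ ^ 2 ≤ a * ‖ξ‖ ^ 2 := by gcongr; exact hl.2
          have h2 : a * ‖ξ‖ ^ 2 = 1 / 4 := by rw [ha]; field_simp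
          nlinarith [Real.pi_pos]
    _ ≤ lowWt ξ := lintegral_mono_set (Ioc_subset_Ioc_right ha1)

/-- The constant in the weighted bound for `curveExt`. -/
def lowIntConst : ENNReal := ∫⁻ l in Ioc (0 : ℝ) 1, ENNReal.ofReal (l ^ (-(19 / 20) : ℝ))

lemma lowIntConst_lt_top : lowIntConst < ⊤ := by
  have h := intervalIntegral.intervalIntegrable_rpow' (a := 0) (b := 1) (r := -(19 / 20))
    (by norm_num)
  rw [intervalIntegrable_iff_integrableOn_Ioc_of_le zero_le_one] at h
  exact h.lintegral_lt_top

lemma measurable_curveExt_mul {c : ℝ → ℂ} (hcm : Measurable c) {y : ℝ → Rn 3}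
    (hy : Measurable y) :
    Measurable fun q : Rn 3 × ℝ => curveExt (fun t => c t * ch (t * q.2)) y q.1 := by
  have n1 : Measurable fun q : (Rn 3 × ℝ) × ℝ => q.1.1 := measurable_fst.comp measurable_fst
  have n2 : Measurable fun q : (Rn 3 × ℝ) × ℝ => q.1.2 := measurable_snd.comp measurable_fst
  have n3 : Measurable fun q : (Rn 3 × ℝ) × ℝ => q.2 := measurable_snd
  have h : Measurable fun q : (Rn 3 × ℝ) × ℝ => (c q.2 * ch (q.2 * q.1.2)) *
      ch (⟪y q.2, q.1.1⟫ + q.2 * ‖q.1.1‖ ^ 2) :=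
    ((hcm.comp n3).mul (measurable_ch.comp (n3.mul n2))).mul
      (measurable_phase (hy.comp n3) n1 n3)
  exact h.stronglyMeasurable.integral_prod_right'.measurable

lemma measurable_curveExt {c : ℝ → ℂ} (hcm : Measurable c) {y : ℝ → Rn 3}
    (hy : Measurable y) : Measurable (curveExt c y) := by
  have h : Measurable fun q : Rn 3 × ℝ => c q.2 * ch (⟪y q.2, q.1⟫ + q.2 * ‖q.1‖ ^ 2) :=
    (hcm.comp measurable_snd).mul
      (measurable_phase (hy.comp measurable_snd) measurable_fst measurable_snd)
  exact h.stronglyMeasurable.integral_prod_right'.measurable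

lemma lintegral_lowWt_curveExt_le {c : ℝ → ℂ} (hc : Integrable c) (hcm : Measurable c)
    {y : ℝ → Rn 3} (hy : Measurable y) :
    ∫⁻ ξ : Rn 3, lowWt ξ * ‖curveExt c y ξ‖ₑ ^ 2
      ≤ lowIntConst * (dispConst * (∫⁻ t, ‖c t‖ₑ ^ (5 / 3 : ℝ)) ^ (6 / 5 : ℝ)) := by
  have hm := measurable_curveExt hcm hy
  have hm2 : Measurable fun q : Rn 3 × ℝ => ‖curveExt c y q.1‖ₑ ^ 2 :=
    ((hm.comp measurable_fst).enorm).pow_const 2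
  have hm3 : Measurable fun q : Rn 3 × ℝ => ENNReal.ofReal (q.2 ^ (-(1 / 4) : ℝ)) *
      ENNReal.ofReal (Real.exp (-(Real.pi * q.2 * ‖q.1‖ ^ 2))) * ‖curveExt c y q.1‖ₑ ^ 2 :=
    measurable_lowWt_integrand.mul hm2
  have hi : ∀ ξ : Rn 3, Measurable fun l : ℝ => ENNReal.ofReal (l ^ (-(1 / 4) : ℝ)) *
      ENNReal.ofReal (Real.exp (-(Real.pi * l * ‖ξ‖ ^ 2))) := fun ξ => by fun_prop
  have hi' : ∀ l : ℝ, Measurable fun ξ : Rn 3 =>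
      ENNReal.ofReal (Real.exp (-(Real.pi * l * ‖ξ‖ ^ 2))) * ‖curveExt c y ξ‖ₑ ^ 2 := fun l =>
    Measurable.mul (by fun_prop) (hm.enorm.pow_const 2)
  calc ∫⁻ ξ : Rn 3, lowWt ξ * ‖curveExt c y ξ‖ₑ ^ 2
      = ∫⁻ ξ : Rn 3, ∫⁻ l in Ioc (0 : ℝ) 1, ENNReal.ofReal (l ^ (-(1 / 4) : ℝ)) *
          ENNReal.ofReal (Real.exp (-(Real.pi * l * ‖ξ‖ ^ 2))) * ‖curveExt c y ξ‖ₑ ^ 2 := by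
        congr 1; ext ξ
        rw [lintegral_mul_const _ (hi ξ), lowWt]
    _ = ∫⁻ l in Ioc (0 : ℝ) 1, ∫⁻ ξ : Rn 3, ENNReal.ofReal (l ^ (-(1 / 4) : ℝ)) *
          ENNReal.ofReal (Real.exp (-(Real.pi * l * ‖ξ‖ ^ 2))) * ‖curveExt c y ξ‖ₑ ^ 2 :=
        lintegral_lintegral_swap hm3.aemeasurable
    _ ≤ ∫⁻ l in Ioc (0 : ℝ) 1, ENNReal.ofReal (l ^ (-(19 / 20) : ℝ)) *
          (dispConst * (∫⁻ t, ‖c t‖ₑ ^ (5 / 3 : ℝ)) ^ (6 / 5 : ℝ)) := by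
        refine setLIntegral_mono' measurableSet_Ioc fun l hl => ?_
        simp only [mul_assoc (ENNReal.ofReal (l ^ (-(1 / 4) : ℝ)))]
        rw [lintegral_const_mul _ (hi' l)]
        refine (mul_le_mul_right (lintegral_gaussian_curveExt_le_rpow hc hcm hy hl.1) _).trans_eq ?_
        rw [← mul_assoc, ← ENNReal.ofReal_mul (Real.rpow_nonneg hl.1.le _), ← Real.rpow_add hl.1]
        norm_num
    _ = _ := by
      rw [lintegral_mul_const _ (by fun_prop), lowIntConst]

/-- The space-time version of `curveExt`. -/
def curveExtST (c : ℝ → ℂ) (y : ℝ → Rn 3) (ξ : Rn 3) (τ : ℝ) : ℂ :=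
  ∫ t, c t * ch (⟪y t, ξ⟫ + t * τ)

lemma curveExtST_add (c : ℝ → ℂ) (y : ℝ → Rn 3) (ξ : Rn 3) (σ : ℝ) :
    curveExtST c y ξ (σ + ‖ξ‖ ^ 2) = curveExt (fun t => c t * ch (t * σ)) y ξ := by
  unfold curveExtST curveExt
  congr 1; ext t
  rw [mul_assoc, ← ch_add]
  ring_nf

lemma lintegral_lowWt_curveExtST_le (b : ℝ) {c : ℝ → ℂ} (hc : Integrable c) (hcm : Measurable c)
    {y : ℝ → Rn 3} (hy : Measurable y) :
    ∫⁻ ξ : Rn 3, ∫⁻ τ : ℝ, lowWt ξ * ENNReal.ofReal (modWt (-b) ξ τ) *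
        ‖curveExtST c y ξ τ‖ₑ ^ 2
      ≤ modConst b * (lowIntConst *
        (dispConst * (∫⁻ t, ‖c t‖ₑ ^ (5 / 3 : ℝ)) ^ (6 / 5 : ℝ))) := by
  have hm := measurable_curveExt_mul hcm hy
  have hj : Measurable fun σ : ℝ => ENNReal.ofReal (japR σ ^ (2 * -b)) := by
    unfold japR; fun_prop
  have hshift : ∀ ξ : Rn 3, ∫⁻ τ : ℝ, lowWt ξ * ENNReal.ofReal (modWt (-b) ξ τ) *
        ‖curveExtST c y ξ τ‖ₑ ^ 2 = ∫⁻ σ : ℝ, lowWt ξ * ENNReal.ofReal (japR σ ^ (2 * -b)) *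
        ‖curveExt (fun t => c t * ch (t * σ)) y ξ‖ₑ ^ 2 := by
    intro ξ
    rw [← lintegral_add_right_eq_self _ (‖ξ‖ ^ 2)]
    simp only [curveExtST_add, modWt, add_sub_cancel_right]
  simp only [hshift]
  rw [lintegral_lintegral_swap]
  swap
  · exact (((measurable_lowWt.comp measurable_fst).mul (hj.comp measurable_snd)).mul
      (hm.enorm.pow_const 2)).aemeasurable
  rw [modConst, ← lintegral_mul_const _ hj]
  refine lintegral_mono fun σ => ?_
  have hcσ : Measurable fun t => c t * ch (t * σ) := hcm.mul (by fun_prop)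
  have hci : Integrable fun t => c t * ch (t * σ) := by
    simpa only [mul_comm] using
      integrable_ch_mul hc (g := fun t => t * σ) (by fun_prop)
  have h := lintegral_lowWt_curveExt_le hci hcσ hy
  have hn : ∀ t, ‖c t * ch (t * σ)‖ₑ = ‖c t‖ₑ := fun t => by
    rw [enorm_mul, ← ofReal_norm (ch _), norm_ch]; simp
  simp only [hn] at h
  refine le_trans (le_of_eq ?_) (mul_le_mul_right h _)
  have hm2 : Measurable fun ξ => lowWt ξ * ‖curveExt (fun t => c t * ch (t * σ)) y ξ‖ₑ ^ 2 :=
    measurable_lowWt.mul ((measurable_curveExt hcσ hy).enorm.pow_const 2)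
  rw [← lintegral_const_mul _ hm2]
  congr 1; ext ξ
  ring

/-! ### The maximal estimate along measurable curves -/

lemma stF_eq_zero_of_support {n : ℕ} {φ : 𝓢(Rn n × ℝ, ℂ)} {r : ℝ}
    (hφ : ∀ t : ℝ, Function.support (fun ξ => 𝓕 (fun x => φ (x, t)) ξ) ⊆ {ξ : Rn n | r ≤ ‖ξ‖})
    {ξ : Rn n} (hξ : ‖ξ‖ < r) (τ : ℝ) : stF φ (ξ, τ) = 0 := by
  have hi : Integrable (fun p : Rn n × ℝ => ch (-(⟪p.1, ξ⟫ + p.2 * τ)) * φ p)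
      (volume.prod volume) := integrable_ch_mul φ.integrable (by fun_prop)
  have hz : ∀ t : ℝ, 𝓕 (fun x => φ (x, t)) ξ = 0 := by
    intro t
    by_contra h
    exact absurd (hφ t h) (by simpa using hξ)
  rw [stF_apply, Measure.volume_eq_prod, integral_prod_symm _ hi]
  have e : ∀ t : ℝ, ∫ x : Rn n, ch (-(⟪x, ξ⟫ + t * τ)) * φ (x, t) = 0 := by
    intro t
    have : ∀ x : Rn n, ch (-(⟪x, ξ⟫ + t * τ)) * φ (x, t)
        = ch (-(t * τ)) * (ch (-⟪x, ξ⟫) * φ (x, t)) := by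
      intro x; rw [← mul_assoc, ← ch_add]; ring_nf
    simp only [this]
    rw [integral_const_mul, ← fourier_eq_ch (fun x => φ (x, t)), hz, mul_zero]
  exact (integral_congr_ae (Filter.Eventually.of_forall e)).trans (integral_zero _ _)

lemma rpow_le_norm_mul_multiplier {s : ℝ} (hs : 3 / 4 ≤ s) {m : Rn 3 → ℝ}
    (hm : IsAdmissibleMultiplier 3 s m) {ξ : Rn 3} (hξ : 1 / 2 ≤ ‖ξ‖) :
    ‖ξ‖ ^ (3 / 4 : ℝ) / 4 ≤ ‖ξ‖ * m ξ := by
  obtain ⟨-, -, -, hmono, -, hhom⟩ := hm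
  have hpos : 0 < ‖ξ‖ := by linarith
  rcases le_total 2 ‖ξ‖ with h | h
  · rw [hhom ξ h]
    have h1 : ‖ξ‖ * ‖ξ‖ ^ (-(1 - s)) = ‖ξ‖ ^ s := by
      rw [mul_comm, ← Real.rpow_add_one hpos.ne']; congr 1; ring
    have h2 : ‖ξ‖ ^ (3 / 4 : ℝ) ≤ ‖ξ‖ ^ s := Real.rpow_le_rpow_of_exponent_le (by linarith) hs
    have h3 : 0 ≤ ‖ξ‖ ^ (3 / 4 : ℝ) := Real.rpow_nonneg hpos.le _
    rw [h1]; linarith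
  · set η : Rn 3 := EuclideanSpace.single 0 2 with hη
    have hηn : ‖η‖ = 2 := by simp [hη]
    have h1 : (1 / 2 : ℝ) ≤ m ξ := by
      refine le_trans ?_ (hmono ξ η (by rw [hηn]; exact h))
      rw [hhom η hηn.ge, hηn]
      have : (2 : ℝ) ^ (-1 : ℝ) ≤ 2 ^ (-(1 - s)) :=
        Real.rpow_le_rpow_of_exponent_le (by norm_num) (by linarith)
      rw [Real.rpow_neg_one] at this
      linarith
    have h2 : ‖ξ‖ ^ (3 / 4 : ℝ) ≤ 2 * ‖ξ‖ := by
      have e : ‖ξ‖ ^ (3 / 4 : ℝ) = ‖ξ‖ ^ (-(1 / 4) : ℝ) * ‖ξ‖ := by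
        rw [← Real.rpow_add_one hpos.ne']; norm_num
      have e2 : ‖ξ‖ ^ (-(1 / 4) : ℝ) ≤ (1 / 2) ^ (-(1 / 4) : ℝ) :=
        Real.rpow_le_rpow_of_nonpos (by norm_num) hξ (by norm_num)
      have e3 : (1 / 2 : ℝ) ^ (-(1 / 4) : ℝ) ≤ (1 / 2) ^ (-1 : ℝ) :=
        Real.rpow_le_rpow_of_exponent_ge (by norm_num) (by norm_num) (by norm_num)
      rw [Real.rpow_neg_one] at e3
      rw [e]
      have : ‖ξ‖ ^ (-(1 / 4) : ℝ) ≤ 2 := by linarith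
      gcongr
    nlinarith

lemma rpow_le_sq_norm_mul_multiplier {s : ℝ} (hs : 3 / 4 ≤ s) {m : Rn 3 → ℝ}
    (hm : IsAdmissibleMultiplier 3 s m) {ξ : Rn 3} (hξ : 1 / 2 ≤ ‖ξ‖) :
    ‖ξ‖ ^ (3 / 2 : ℝ) ≤ (2 * Real.pi * ‖ξ‖ * m ξ) ^ 2 := by
  have h := rpow_le_norm_mul_multiplier hs hm hξ
  have e : ‖ξ‖ ^ (3 / 2 : ℝ) = (‖ξ‖ ^ (3 / 4 : ℝ)) ^ 2 := by
    rw [← Real.rpow_natCast, ← Real.rpow_mul (norm_nonneg _)]; norm_num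
  have h0 : 0 ≤ ‖ξ‖ ^ (3 / 4 : ℝ) := Real.rpow_nonneg (norm_nonneg _) _
  rw [e]
  refine pow_le_pow_left₀ h0 ?_ 2
  have h3 := Real.pi_gt_three
  calc ‖ξ‖ ^ (3 / 4 : ℝ) ≤ 2 * 3 * (‖ξ‖ ^ (3 / 4 : ℝ) / 4) := by linarith
    _ ≤ 2 * Real.pi * (‖ξ‖ * m ξ) := by gcongr
    _ = _ := by ring

/-- The squared norm `∫∫ ⟨τ-|ξ|²⟩^{2b} |ξ|^{3/2} |φ̃|²`. -/
def highSq (b : ℝ) (φ : 𝓢(Rn 3 × ℝ, ℂ)) : ENNReal :=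
  ∫⁻ p : Rn 3 × ℝ, ENNReal.ofReal (modWt b p.1 p.2) * ENNReal.ofReal (‖p.1‖ ^ (3 / 2 : ℝ)) *
    ‖stF φ p‖ₑ ^ 2

lemma measurable_highSq_weight (b : ℝ) : Measurable fun p : Rn 3 × ℝ =>
    ENNReal.ofReal (modWt b p.1 p.2) * ENNReal.ofReal (‖p.1‖ ^ (3 / 2 : ℝ)) :=
  (measurable_ofReal_modWt b).mul (by fun_prop)

lemma highSq_le {s : ℝ} (hs : 3 / 4 ≤ s) (hs1 : s ≤ 1) {m : Rn 3 → ℝ}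
    (hm : IsAdmissibleMultiplier 3 s m) (b : ℝ) {φ : 𝓢(Rn 3 × ℝ, ℂ)}
    (hφ : ∀ t : ℝ, Function.support (fun ξ => 𝓕 (fun x => φ (x, t)) ξ) ⊆
      {ξ : Rn 3 | 1 / 2 ≤ ‖ξ‖}) :
    highSq b φ ≤
      ENNReal.ofReal (XNorm 3 0 b (fun x t => gradC (Iop m 1 (fun y => φ (y, t))) x)) ^ 2 := by
  have hmt := hm.hasTemperateGrowth hs1
  have hmeas : Measurable fun p : Rn 3 × ℝ => ENNReal.ofReal (modWt b p.1 p.2) *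
      ENNReal.ofReal (‖p.1‖ ^ (3 / 2 : ℝ)) * ‖stF φ p‖ₑ ^ 2 :=
    (measurable_highSq_weight b).mul ((stF φ).continuous.measurable.enorm.pow_const 2)
  rw [ofReal_sq_XNorm_gradC hmt b φ, highSq, Measure.volume_eq_prod,
    lintegral_prod _ hmeas.aemeasurable]
  refine lintegral_mono fun ξ => lintegral_mono fun τ => ?_
  dsimp only
  rw [mul_assoc]
  gcongr
  have e : ∑ i, ‖stF (gradSmoothed m φ i) (ξ, τ)‖ₑ ^ 2
      = ENNReal.ofReal ((2 * Real.pi * ‖ξ‖ * m ξ) ^ 2 * ‖stF φ (ξ, τ)‖ ^ 2) := by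
    rw [← sum_norm_sq_stF_gradSmoothed hmt, ENNReal.ofReal_sum_of_nonneg (fun i _ => by positivity)]
    refine Finset.sum_congr rfl fun i _ => ?_
    rw [ENNReal.ofReal_pow (norm_nonneg _), ofReal_norm]
  rw [e, ← ofReal_norm, ← ENNReal.ofReal_pow (norm_nonneg _), ← ENNReal.ofReal_mul
    (Real.rpow_nonneg (norm_nonneg _) _)]
  refine ENNReal.ofReal_le_ofReal ?_
  rcases lt_or_ge ‖ξ‖ (1 / 2) with h | h
  · rw [stF_eq_zero_of_support hφ h]; simp
  · gcongr
    exact rpow_le_sq_norm_mul_multiplier hs hm h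

lemma xSq_le_highSq (b : ℝ) {φ : 𝓢(Rn 3 × ℝ, ℂ)}
    (hφ : ∀ t : ℝ, Function.support (fun ξ => 𝓕 (fun x => φ (x, t)) ξ) ⊆
      {ξ : Rn 3 | 1 / 2 ≤ ‖ξ‖}) : xSq b φ ≤ 4 * highSq b φ := by
  have hmeas : Measurable fun p : Rn 3 × ℝ => ENNReal.ofReal (modWt b p.1 p.2) *
      ENNReal.ofReal (‖p.1‖ ^ (3 / 2 : ℝ)) * ‖stF φ p‖ₑ ^ 2 :=
    (measurable_highSq_weight b).mul ((stF φ).continuous.measurable.enorm.pow_const 2)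
  rw [highSq, ← lintegral_const_mul _ hmeas, Measure.volume_eq_prod,
    lintegral_prod _ (hmeas.const_mul 4).aemeasurable]
  refine lintegral_mono fun ξ => lintegral_mono fun τ => ?_
  dsimp only
  rcases lt_or_ge ‖ξ‖ (1 / 2) with h | h
  · rw [stF_eq_zero_of_support hφ h]; simp
  · have h1 : (1 : ENNReal) ≤ 4 * ENNReal.ofReal (‖ξ‖ ^ (3 / 2 : ℝ)) := by
      have e : (1 / 2 : ℝ) ^ (3 / 2 : ℝ) ≤ ‖ξ‖ ^ (3 / 2 : ℝ) :=
        Real.rpow_le_rpow (by norm_num) h (by norm_num)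
      have e2 : (1 / 2 : ℝ) ^ (2 : ℝ) ≤ (1 / 2) ^ (3 / 2 : ℝ) :=
        Real.rpow_le_rpow_of_exponent_ge (by norm_num) (by norm_num) (by norm_num)
      norm_num at e2
      rw [← ENNReal.ofReal_one, ← ENNReal.ofReal_ofNat 4, ← ENNReal.ofReal_mul (by norm_num)]
      refine ENNReal.ofReal_le_ofReal ?_
      norm_num at e ⊢
      linarith
    calc ENNReal.ofReal (modWt b ξ τ) * ‖stF φ (ξ, τ)‖ₑ ^ 2
        ≤ (4 * ENNReal.ofReal (‖ξ‖ ^ (3 / 2 : ℝ))) *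
          (ENNReal.ofReal (modWt b ξ τ) * ‖stF φ (ξ, τ)‖ₑ ^ 2) := le_mul_of_one_le_left zero_le h1
      _ = _ := by ring

/-- The constant in the maximal estimate. -/
def curveConst (b : ℝ) : ENNReal :=
  ENNReal.ofReal lowConst⁻¹ * (modConst b * (lowIntConst * dispConst))

lemma curveConst_lt_top {b : ℝ} (hb : 1 / 2 < b) : curveConst b < ⊤ :=
  ENNReal.mul_lt_top ENNReal.ofReal_lt_top (ENNReal.mul_lt_top (modConst_lt_top hb)
    (ENNReal.mul_lt_top lowIntConst_lt_top dispConst_lt_top))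

lemma one_le_weight_mul (b : ℝ) {ξ : Rn 3} (hξ : 1 / 2 ≤ ‖ξ‖) (τ : ℝ) :
    1 ≤ (ENNReal.ofReal (modWt b ξ τ) * ENNReal.ofReal (‖ξ‖ ^ (3 / 2 : ℝ))) *
      (ENNReal.ofReal lowConst⁻¹ * (lowWt ξ * ENNReal.ofReal (modWt (-b) ξ τ))) := by
  have hpos : 0 < ‖ξ‖ := by linarith
  calc (1 : ENNReal) = (ENNReal.ofReal (modWt b ξ τ) * ENNReal.ofReal (modWt (-b) ξ τ)) *
        (ENNReal.ofReal (‖ξ‖ ^ (3 / 2 : ℝ)) * (ENNReal.ofReal lowConst⁻¹ *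
          ENNReal.ofReal (lowConst * ‖ξ‖ ^ (-(3 / 2) : ℝ)))) := by
        have hl := lowConst_pos
        rw [ofReal_modWt_mul_neg, one_mul, ← ENNReal.ofReal_mul (by positivity),
          ← ENNReal.ofReal_mul (by positivity), inv_mul_cancel_left₀ hl.ne',
          ← Real.rpow_add hpos]
        simp
    _ ≤ (ENNReal.ofReal (modWt b ξ τ) * ENNReal.ofReal (modWt (-b) ξ τ)) *
        (ENNReal.ofReal (‖ξ‖ ^ (3 / 2 : ℝ)) * (ENNReal.ofReal lowConst⁻¹ * lowWt ξ)) := by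
        gcongr
        exact le_lowWt hξ
    _ = _ := by ring

lemma measurable_curveExtST {c : ℝ → ℂ} (hcm : Measurable c) {y : ℝ → Rn 3} (hy : Measurable y) :
    Measurable fun p : Rn 3 × ℝ => curveExtST c y p.1 p.2 := by
  have n1 : Measurable fun q : (Rn 3 × ℝ) × ℝ => q.1.1 := measurable_fst.comp measurable_fst
  have n2 : Measurable fun q : (Rn 3 × ℝ) × ℝ => q.1.2 := measurable_snd.comp measurable_fst
  have n3 : Measurable fun q : (Rn 3 × ℝ) × ℝ => q.2 := measurable_snd
  have n4 : Measurable fun q : (Rn 3 × ℝ) × ℝ => (⟪y q.2, q.1.1⟫ : ℝ) := (hy.comp n3).inner n1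
  have h : Measurable fun q : (Rn 3 × ℝ) × ℝ => c q.2 * ch (⟪y q.2, q.1.1⟫ + q.2 * q.1.2) :=
    (hcm.comp n3).mul (measurable_ch.comp (n4.add (n3.mul n2)))
  exact h.stronglyMeasurable.integral_prod_right'.measurable

lemma integral_mul_curve_eq {c : ℝ → ℂ} (hc : Integrable c)
    {y : ℝ → Rn 3} (hy : Measurable y) (φ : 𝓢(Rn 3 × ℝ, ℂ)) :
    ∫ t, c t * φ (y t, t) = ∫ p : Rn 3 × ℝ, stF φ p * curveExtST c y p.1 p.2 := by
  have n1 : Measurable fun q : ℝ × (Rn 3 × ℝ) => q.2.1 := measurable_fst.comp measurable_snd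
  have n2 : Measurable fun q : ℝ × (Rn 3 × ℝ) => q.2.2 := measurable_snd.comp measurable_snd
  have n3 : Measurable fun q : ℝ × (Rn 3 × ℝ) => q.1 := measurable_fst
  have n4 : Measurable fun q : ℝ × (Rn 3 × ℝ) => (⟪y q.1, q.2.1⟫ : ℝ) := (hy.comp n3).inner n1
  have hF : Integrable (fun q : ℝ × (Rn 3 × ℝ) =>
      ch (⟪y q.1, q.2.1⟫ + q.1 * q.2.2) * (c q.1 * stF φ q.2)) (volume.prod volume) :=
    integrable_ch_mul (hc.mul_prod (stF φ).integrable)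
      (n4.add (n3.mul n2)).aestronglyMeasurable
  have e1 : ∀ t, c t * φ (y t, t)
      = ∫ p : Rn 3 × ℝ, ch (⟪y t, p.1⟫ + t * p.2) * (c t * stF φ p) := by
    intro t
    have h := stFInv_apply (stF φ) (y t) t
    rw [stFInv_stF] at h
    rw [h, ← integral_const_mul]
    congr 1; ext p
    rw [real_inner_comm, mul_comm p.2 t]; ring
  simp only [e1]
  rw [integral_integral_swap (f := fun t p => ch (⟪y t, p.1⟫ + t * p.2) * (c t * stF φ p)) hF]
  congr 1; ext p
  rw [curveExtST, ← integral_const_mul]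
  congr 1; ext t
  ring

lemma lintegral_curve_rpow_le (b : ℝ) {φ : 𝓢(Rn 3 × ℝ, ℂ)}
    (hφ : ∀ t : ℝ, Function.support (fun ξ => 𝓕 (fun x => φ (x, t)) ξ) ⊆
      {ξ : Rn 3 | 1 / 2 ≤ ‖ξ‖}) {y : ℝ → Rn 3} (hy : Measurable y) :
    ∫⁻ t, ‖φ (y t, t)‖ₑ ^ (5 / 2 : ℝ) ≤ (curveConst b * highSq b φ) ^ (5 / 4 : ℝ) := by
  set d : ℝ → ℂ := fun t => φ (y t, t) with hd
  have hdm : Measurable d := φ.continuous.measurable.comp (hy.prodMk measurable_id)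
  obtain ⟨C, hC⟩ := SchwartzMap.exists_decay_snd φ
  have hdi : Integrable d := (integrable_inv_one_add_sq.const_mul C).mono'
    hdm.aestronglyMeasurable (Filter.Eventually.of_forall fun t => hC (y t) t)
  have hC0 : 0 ≤ C := by simpa using (norm_nonneg _).trans (hC 0 0)
  have hdC : ∀ t, ‖d t‖ ≤ C := fun t => (hC (y t) t).trans
    (mul_le_of_le_one_right hC0 (inv_le_one_of_one_le₀ (by nlinarith [sq_nonneg t])))
  set c : ℝ → ℂ := fun t => (starRingEnd ℂ) (d t) * ((‖d t‖ ^ (1 / 2 : ℝ) : ℝ) : ℂ) with hc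
  have hcm : Measurable c := (Complex.continuous_conj.measurable.comp hdm).mul
    (Complex.measurable_ofReal.comp (hdm.norm.pow_const _))
  have hcn : ∀ t, ‖c t‖ = ‖d t‖ ^ (3 / 2 : ℝ) := by
    intro t
    rw [hc]
    simp only [norm_mul, RCLike.norm_conj, Complex.norm_real]
    rw [Real.norm_of_nonneg (by positivity), ← Real.rpow_one_add' (norm_nonneg _) (by norm_num)]
    norm_num
  have hci : Integrable c := by
    refine (hdi.norm.const_mul (C ^ (1 / 2 : ℝ))).mono' hcm.aestronglyMeasurable
      (Filter.Eventually.of_forall fun t => ?_)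
    rw [hc]
    simp only [norm_mul, RCLike.norm_conj, Complex.norm_real]
    rw [Real.norm_of_nonneg (by positivity), mul_comm]
    gcongr
    exact hdC t
  set A : ENNReal := ∫⁻ t, ‖d t‖ₑ ^ (5 / 2 : ℝ) with hA
  have hcA : ∫⁻ t, ‖c t‖ₑ ^ (5 / 3 : ℝ) = A := by
    congr 1; ext t
    rw [← ofReal_norm, hcn, ← ENNReal.ofReal_rpow_of_nonneg (norm_nonneg _) (by norm_num),
      ofReal_norm, ← ENNReal.rpow_mul]
    norm_num
  have hcd : ∀ t, c t * d t = ((‖d t‖ ^ (5 / 2 : ℝ) : ℝ) : ℂ) := by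
    intro t
    have : ‖d t‖ ^ (5 / 2 : ℝ) = ‖d t‖ ^ (1 / 2 : ℝ) * ‖d t‖ ^ 2 := by
      rw [← Real.rpow_natCast, ← Real.rpow_add' (norm_nonneg _) (by norm_num)]; norm_num
    rw [this, hc]
    push_cast
    rw [← Complex.mul_conj']; ring
  have hcdi : Integrable fun t => ‖d t‖ ^ (5 / 2 : ℝ) := by
    have h1 : Integrable fun t => c t * d t :=
      hci.mul_bdd (c := C) hdm.aestronglyMeasurable (Filter.Eventually.of_forall hdC)
    refine h1.norm.congr (Filter.Eventually.of_forall fun t => ?_)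
    simp only [hcd, Complex.norm_real]
    exact Real.norm_of_nonneg (by positivity)
  have hAr : A = ENNReal.ofReal (∫ t, ‖d t‖ ^ (5 / 2 : ℝ)) := by
    rw [ofReal_integral_eq_lintegral_ofReal hcdi
      (Filter.Eventually.of_forall fun t => by positivity), hA]
    congr 1; ext t
    rw [← ENNReal.ofReal_rpow_of_nonneg (norm_nonneg _) (by norm_num), ofReal_norm]
  have hAtop : A ≠ ⊤ := by rw [hAr]; exact ENNReal.ofReal_ne_top
  have hA1 : A ≤ ∫⁻ p : Rn 3 × ℝ, ‖stF φ p‖ₑ * ‖curveExtST c y p.1 p.2‖ₑ := by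
    have h1 : A = ‖∫ t, c t * d t‖ₑ := by
      simp only [hcd]
      rw [integral_complex_ofReal, ← ofReal_norm, Complex.norm_real,
        Real.norm_of_nonneg (integral_nonneg fun t => by positivity), hAr]
    rw [h1, hd, integral_mul_curve_eq hci hy φ]
    refine (enorm_integral_le_lintegral_enorm _).trans_eq ?_
    simp only [enorm_mul]
  have hHm := measurable_curveExtST hcm hy
  have hw' : Measurable fun p : Rn 3 × ℝ =>
      ENNReal.ofReal lowConst⁻¹ * (lowWt p.1 * ENNReal.ofReal (modWt (-b) p.1 p.2)) :=
    ((measurable_lowWt.comp measurable_fst).mul (measurable_ofReal_modWt (-b))).const_mul _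
  have hA2 : A ^ 2 ≤ highSq b φ * (curveConst b * A ^ (6 / 5 : ℝ)) := by
    refine (pow_le_pow_left' hA1 2).trans ((sq_lintegral_mul_le
      (stF φ).continuous.measurable.enorm hHm.enorm (measurable_highSq_weight b) hw' ?_).trans ?_)
    · rintro ⟨ξ, τ⟩ hp
      refine one_le_weight_mul b ?_ τ
      by_contra! h
      exact hp (by simp [stF_eq_zero_of_support hφ h])
    · refine mul_le_mul_right ?_ _
      have hm3 : Measurable fun p : Rn 3 × ℝ => lowWt p.1 * ENNReal.ofReal (modWt (-b) p.1 p.2) *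
          ‖curveExtST c y p.1 p.2‖ₑ ^ 2 :=
        ((measurable_lowWt.comp measurable_fst).mul (measurable_ofReal_modWt (-b))).mul
          (hHm.enorm.pow_const 2)
      simp only [mul_assoc (ENNReal.ofReal lowConst⁻¹)]
      rw [lintegral_const_mul _ hm3, Measure.volume_eq_prod, lintegral_prod _ hm3.aemeasurable,
        curveConst]
      have h := lintegral_lowWt_curveExtST_le b hci hcm hy
      rw [hcA] at h
      refine (mul_le_mul_right h _).trans_eq ?_
      ring
  rcases eq_or_ne A 0 with h0 | h0
  · rw [h0]; exact zero_le
  have h65 : A ^ (6 / 5 : ℝ) ≠ 0 := by simp [h0, hAtop]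
  have h65' : A ^ (6 / 5 : ℝ) ≠ ⊤ := ENNReal.rpow_ne_top_of_nonneg (by norm_num) hAtop
  have hA3 : A ^ (4 / 5 : ℝ) ≤ curveConst b * highSq b φ := by
    rw [← ENNReal.mul_le_mul_iff_left h65 h65', ← ENNReal.rpow_add _ _ h0 hAtop]
    calc A ^ (4 / 5 + 6 / 5 : ℝ) = A ^ 2 := by
          rw [← ENNReal.rpow_natCast]; norm_num
      _ ≤ _ := hA2
      _ = _ := by ring
  calc A = (A ^ (4 / 5 : ℝ)) ^ (5 / 4 : ℝ) := by rw [← ENNReal.rpow_mul]; norm_num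
    _ ≤ _ := ENNReal.rpow_le_rpow hA3 (by norm_num)

/-! ### The maximal function -/

/-- The spatial supremum of `‖φ(·,t)‖`, taken along a dense sequence. -/
def maxAbs (φ : 𝓢(Rn 3 × ℝ, ℂ)) (t : ℝ) : ENNReal :=
  ⨆ n, ‖φ (TopologicalSpace.denseSeq (Rn 3) n, t)‖ₑ

lemma measurable_maxAbs (φ : 𝓢(Rn 3 × ℝ, ℂ)) : Measurable (maxAbs φ) := by
  refine Measurable.iSup fun n => ?_
  have h : Continuous fun t : ℝ => φ (TopologicalSpace.denseSeq (Rn 3) n, t) :=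
    φ.continuous.comp (by fun_prop)
  exact h.measurable.enorm

lemma enorm_le_maxAbs (φ : 𝓢(Rn 3 × ℝ, ℂ)) (x : Rn 3) (t : ℝ) : ‖φ (x, t)‖ₑ ≤ maxAbs φ t := by
  have h : Continuous fun x : Rn 3 => φ (x, t) := φ.continuous.comp (by fun_prop)
  exact isClosed_property (p := fun x => ‖φ (x, t)‖ₑ ≤ maxAbs φ t)
    (TopologicalSpace.denseRange_denseSeq (Rn 3))
    (isClosed_le h.enorm continuous_const)
    (fun n => le_iSup (fun n => ‖φ (TopologicalSpace.denseSeq (Rn 3) n, t)‖ₑ) n) x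

/-- A maximizer of `‖φ(·,t)‖` among the first `n + 1` points of a dense sequence. -/
def maxCurve (φ : 𝓢(Rn 3 × ℝ, ℂ)) : ℕ → ℝ → Rn 3
  | 0, _ => TopologicalSpace.denseSeq (Rn 3) 0
  | n + 1, t =>
    if ‖φ (maxCurve φ n t, t)‖ₑ < ‖φ (TopologicalSpace.denseSeq (Rn 3) (n + 1), t)‖ₑ then
      TopologicalSpace.denseSeq (Rn 3) (n + 1) else maxCurve φ n t

lemma measurable_enorm_curve (φ : 𝓢(Rn 3 × ℝ, ℂ)) {y : ℝ → Rn 3} (hy : Measurable y) :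
    Measurable fun t => ‖φ (y t, t)‖ₑ := by
  have h : Measurable fun t => φ (y t, t) :=
    φ.continuous.measurable.comp (hy.prodMk measurable_id)
  exact h.enorm

lemma measurable_maxCurve (φ : 𝓢(Rn 3 × ℝ, ℂ)) (n : ℕ) : Measurable (maxCurve φ n) := by
  induction n with
  | zero => exact measurable_const
  | succ n ih =>
    exact Measurable.ite (measurableSet_lt (measurable_enorm_curve φ ih)
      (measurable_enorm_curve φ measurable_const)) measurable_const ih

lemma enorm_maxCurve_succ (φ : 𝓢(Rn 3 × ℝ, ℂ)) (n : ℕ) (t : ℝ) :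
    ‖φ (maxCurve φ (n + 1) t, t)‖ₑ =
      max ‖φ (maxCurve φ n t, t)‖ₑ ‖φ (TopologicalSpace.denseSeq (Rn 3) (n + 1), t)‖ₑ := by
  rw [maxCurve]
  split_ifs with h
  · exact (max_eq_right h.le).symm
  · exact (max_eq_left (not_lt.mp h)).symm

lemma maxAbs_le_iSup_maxCurve (φ : 𝓢(Rn 3 × ℝ, ℂ)) (t : ℝ) :
    maxAbs φ t ≤ ⨆ n, ‖φ (maxCurve φ n t, t)‖ₑ := by
  refine iSup_mono fun n => ?_
  cases n with
  | zero => rfl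
  | succ n => rw [enorm_maxCurve_succ]; exact le_max_right _ _

/-- The maximal estimate `‖φ‖_{L^{5/2}_t L^∞_x}`. -/
lemma lintegral_maxAbs_rpow_le (b : ℝ) {φ : 𝓢(Rn 3 × ℝ, ℂ)}
    (hφ : ∀ t : ℝ, Function.support (fun ξ => 𝓕 (fun x => φ (x, t)) ξ) ⊆
      {ξ : Rn 3 | 1 / 2 ≤ ‖ξ‖}) :
    ∫⁻ t, maxAbs φ t ^ (5 / 2 : ℝ) ≤ (curveConst b * highSq b φ) ^ (5 / 4 : ℝ) := by
  have hmono : Monotone fun n t => ‖φ (maxCurve φ n t, t)‖ₑ ^ (5 / 2 : ℝ) := by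
    refine monotone_nat_of_le_succ fun n t => ?_
    dsimp only
    rw [enorm_maxCurve_succ]
    exact ENNReal.rpow_le_rpow (le_max_left _ _) (by norm_num)
  have hsup : ∀ t, (⨆ n, ‖φ (maxCurve φ n t, t)‖ₑ) ^ (5 / 2 : ℝ)
      = ⨆ n, ‖φ (maxCurve φ n t, t)‖ₑ ^ (5 / 2 : ℝ) := fun t =>
    (ENNReal.orderIsoRpow (5 / 2) (by norm_num)).map_iSup _
  calc ∫⁻ t, maxAbs φ t ^ (5 / 2 : ℝ)
      ≤ ∫⁻ t, ⨆ n, ‖φ (maxCurve φ n t, t)‖ₑ ^ (5 / 2 : ℝ) := lintegral_mono fun t => by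
        dsimp only
        rw [← hsup]
        exact ENNReal.rpow_le_rpow (maxAbs_le_iSup_maxCurve φ t) (by norm_num)
    _ = ⨆ n, ∫⁻ t, ‖φ (maxCurve φ n t, t)‖ₑ ^ (5 / 2 : ℝ) := lintegral_iSup
        (fun n => (measurable_enorm_curve φ (measurable_maxCurve φ n)).pow_const _) hmono
    _ ≤ _ := iSup_le fun n => lintegral_curve_rpow_le b hφ (measurable_maxCurve φ n)

/-! ### The trilinear estimate -/

lemma ofReal_lpNormST_le {n : ℕ} {E : Type*} [NormedAddCommGroup E] {p : ℝ} (hp : 0 ≤ p)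
    (F : Rn n → ℝ → E) :
    ENNReal.ofReal (lpNormST n p F) ≤ (∫⁻ t, ∫⁻ x, ‖F x t‖ₑ ^ p) ^ (1 / p) := by
  have h0 : 0 ≤ ∫ t : ℝ, ∫ x : Rn n, ‖F x t‖ ^ p :=
    integral_nonneg fun t => integral_nonneg fun x => by positivity
  rw [lpNormST, ← ENNReal.ofReal_rpow_of_nonneg h0 (by positivity)]
  refine ENNReal.rpow_le_rpow ?_ (by positivity)
  rw [← Real.enorm_of_nonneg h0]
  refine (enorm_integral_le_lintegral_enorm _).trans (lintegral_mono fun t => ?_)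
  refine (enorm_integral_le_lintegral_enorm _).trans (lintegral_mono fun x => ?_)
  dsimp only
  rw [Real.enorm_of_nonneg (by positivity), ← ENNReal.ofReal_rpow_of_nonneg (norm_nonneg _) hp,
    ofReal_norm]

lemma lintegral_enorm_sq_gradC_le {m : Rn 3 → ℝ} (hm : m.HasTemperateGrowth) (b : ℝ)
    (φ : 𝓢(Rn 3 × ℝ, ℂ)) (t : ℝ) :
    ∫⁻ x, ‖gradC (Iop m 1 (fun y => φ (y, t))) x‖ₑ ^ 2 ≤ modConst b *
      ENNReal.ofReal (XNorm 3 0 b (fun x t => gradC (Iop m 1 (fun y => φ (y, t))) x)) ^ 2 := by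
  have e : ∀ x, ‖gradC (Iop m 1 (fun y => φ (y, t))) x‖ₑ ^ 2
      = ∑ i, ‖gradSmoothed m φ i (x, t)‖ₑ ^ 2 := by
    intro x
    rw [← ofReal_norm, ← ENNReal.ofReal_pow (norm_nonneg _), EuclideanSpace.norm_sq_eq,
      ENNReal.ofReal_sum_of_nonneg (fun i _ => by positivity)]
    refine Finset.sum_congr rfl fun i _ => ?_
    rw [ENNReal.ofReal_pow (norm_nonneg _), ofReal_norm, gradC_Iop_apply hm]
  have hmeas : ∀ i, Measurable fun x : Rn 3 => ‖gradSmoothed m φ i (x, t)‖ₑ ^ 2 := by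
    intro i
    have h : Continuous fun x : Rn 3 => gradSmoothed m φ i (x, t) :=
      (gradSmoothed m φ i).continuous.comp (by fun_prop)
    exact h.measurable.enorm.pow_const 2
  simp only [e]
  rw [lintegral_finsetSum _ fun i _ => hmeas i, ← sum_xSq_gradSmoothed hm, Finset.mul_sum]
  exact Finset.sum_le_sum fun i _ => lintegral_enorm_sq_slice_le b _ t

lemma continuous_gradC_Iop {m : Rn 3 → ℝ} (hm : m.HasTemperateGrowth)
    (φ : 𝓢(Rn 3 × ℝ, ℂ)) (t : ℝ) :
    Continuous fun x => gradC (Iop m 1 (fun y => φ (y, t))) x := by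
  rw [(PiLp.homeomorph 2 fun _ : Fin 3 => ℂ).isInducing.continuous_iff]
  refine continuous_pi fun i => ?_
  have h : Continuous fun x : Rn 3 => gradSmoothed m φ i (x, t) :=
    (gradSmoothed m φ i).continuous.comp (by fun_prop)
  exact h.congr fun x => (gradC_Iop_apply hm φ x t i).symm

lemma lintegral_trilinear_le {E : Type*} [NormedAddCommGroup E] [NormedSpace ℂ E]
    (φ₂ φ₃ : 𝓢(Rn 3 × ℝ, ℂ)) {v : Rn 3 → ℝ → E} (hv : ∀ t, Continuous fun x => v x t)
    {S V : ENNReal} (hS : ∀ t, ∫⁻ x, ‖φ₃ (x, t)‖ₑ ^ 2 ≤ S) (hV : ∀ t, ∫⁻ x, ‖v x t‖ₑ ^ 2 ≤ V) :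
    ∫⁻ t, ∫⁻ x, ‖(φ₂ (x, t) * φ₃ (x, t)) • v x t‖ₑ ^ (3 / 2 : ℝ) ≤
      ((∫⁻ t, maxAbs φ₂ t ^ (5 / 2 : ℝ)) ^ (3 / 5 : ℝ) *
        (∫⁻ t, maxAbs φ₃ t ^ (5 / 2 : ℝ)) ^ (2 / 5 : ℝ)) *
      (S ^ (1 / 4 : ℝ) * V ^ (3 / 4 : ℝ)) := by
  have hx : ∀ t, ∫⁻ x, ‖(φ₂ (x, t) * φ₃ (x, t)) • v x t‖ₑ ^ (3 / 2 : ℝ) ≤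
      (maxAbs φ₂ t ^ (3 / 2 : ℝ) * maxAbs φ₃ t) * (S ^ (1 / 4 : ℝ) * V ^ (3 / 4 : ℝ)) := by
    intro t
    have h3 : Continuous fun x : Rn 3 => φ₃ (x, t) := φ₃.continuous.comp (by fun_prop)
    have m3 : Measurable fun x : Rn 3 => ‖φ₃ (x, t)‖ₑ ^ 2 := h3.enorm.measurable.pow_const 2
    have mv : Measurable fun x : Rn 3 => ‖v x t‖ₑ ^ 2 := (hv t).enorm.measurable.pow_const 2
    have mp : Measurable fun x : Rn 3 =>
        (‖φ₃ (x, t)‖ₑ ^ 2) ^ (1 / 4 : ℝ) * (‖v x t‖ₑ ^ 2) ^ (3 / 4 : ℝ) :=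
      (m3.pow_const _).mul (mv.pow_const _)
    calc ∫⁻ x, ‖(φ₂ (x, t) * φ₃ (x, t)) • v x t‖ₑ ^ (3 / 2 : ℝ)
        ≤ ∫⁻ x, (maxAbs φ₂ t ^ (3 / 2 : ℝ) * maxAbs φ₃ t) *
          ((‖φ₃ (x, t)‖ₑ ^ 2) ^ (1 / 4 : ℝ) * (‖v x t‖ₑ ^ 2) ^ (3 / 4 : ℝ)) := by
          refine lintegral_mono fun x => ?_
          have e3 : ‖φ₃ (x, t)‖ₑ ^ (3 / 2 : ℝ)
              = ‖φ₃ (x, t)‖ₑ * (‖φ₃ (x, t)‖ₑ ^ 2) ^ (1 / 4 : ℝ) := by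
            rw [← ENNReal.rpow_natCast, ← ENNReal.rpow_mul]
            nth_rewrite 2 [← ENNReal.rpow_one ‖φ₃ (x, t)‖ₑ]
            rw [← ENNReal.rpow_add_of_nonneg _ _ (by norm_num) (by norm_num)]
            norm_num
          have ev : ‖v x t‖ₑ ^ (3 / 2 : ℝ) = (‖v x t‖ₑ ^ 2) ^ (3 / 4 : ℝ) := by
            rw [← ENNReal.rpow_natCast, ← ENNReal.rpow_mul]
            norm_num
          rw [enorm_smul, enorm_mul, ENNReal.mul_rpow_of_nonneg _ _ (by norm_num),
            ENNReal.mul_rpow_of_nonneg _ _ (by norm_num), e3, ev]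
          calc _ ≤ maxAbs φ₂ t ^ (3 / 2 : ℝ) * (maxAbs φ₃ t * (‖φ₃ (x, t)‖ₑ ^ 2) ^ (1 / 4 : ℝ)) *
                (‖v x t‖ₑ ^ 2) ^ (3 / 4 : ℝ) := by
                gcongr <;> exact enorm_le_maxAbs _ x t
            _ = _ := by ring
      _ = (maxAbs φ₂ t ^ (3 / 2 : ℝ) * maxAbs φ₃ t) *
          ∫⁻ x, (‖φ₃ (x, t)‖ₑ ^ 2) ^ (1 / 4 : ℝ) * (‖v x t‖ₑ ^ 2) ^ (3 / 4 : ℝ) :=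
          lintegral_const_mul _ mp
      _ ≤ _ := by
          refine mul_le_mul_right ((ENNReal.lintegral_mul_norm_pow_le m3.aemeasurable
            mv.aemeasurable (by norm_num) (by norm_num) (by norm_num)).trans ?_) _
          gcongr
          · exact hS t
          · exact hV t
  have hM2 := measurable_maxAbs φ₂
  have hM3 := measurable_maxAbs φ₃
  have m5 : Measurable fun t => maxAbs φ₂ t ^ (3 / 2 : ℝ) * maxAbs φ₃ t :=
    (hM2.pow_const _).mul hM3
  have m2 : Measurable fun t => maxAbs φ₂ t ^ (5 / 2 : ℝ) := hM2.pow_const _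
  have m3 : Measurable fun t => maxAbs φ₃ t ^ (5 / 2 : ℝ) := hM3.pow_const _
  refine (lintegral_mono hx).trans ?_
  rw [lintegral_mul_const _ m5]
  gcongr
  refine le_trans (le_of_eq ?_) (ENNReal.lintegral_mul_norm_pow_le m2.aemeasurable
    m3.aemeasurable (p := 3 / 5) (q := 2 / 5) (by norm_num) (by norm_num) (by norm_num))
  congr 1; ext t
  rw [← ENNReal.rpow_mul, ← ENNReal.rpow_mul]
  norm_num

lemma XNorm_nonneg {n : ℕ} {E : Type*} [NormedAddCommGroup E] [NormedSpace ℂ E] (s b : ℝ)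
    (ψ : Rn n → ℝ → E) : 0 ≤ XNorm n s b ψ :=
  Real.rpow_nonneg (integral_nonneg fun ξ => integral_nonneg fun τ => mul_nonneg (mul_nonneg
    (Real.rpow_nonneg (Real.sqrt_nonneg _) _) (Real.rpow_nonneg (Real.sqrt_nonneg _) _))
    (by positivity)) _

lemma trilinear_const_mul (K L B x₁ x₂ x₃ : ENNReal) :
    ((K ^ (3 / 4 : ℝ) * K ^ (1 / 2 : ℝ)) * (L ^ (1 / 4 : ℝ) * B ^ (3 / 4 : ℝ))) ^ (2 / 3 : ℝ) *
      (x₁ * x₂ * x₃) =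
    ((((K * x₂ ^ 2) ^ (5 / 4 : ℝ)) ^ (3 / 5 : ℝ) * ((K * x₃ ^ 2) ^ (5 / 4 : ℝ)) ^ (2 / 5 : ℝ)) *
      ((L * x₃ ^ 2) ^ (1 / 4 : ℝ) * (B * x₁ ^ 2) ^ (3 / 4 : ℝ))) ^ (2 / 3 : ℝ) := by
  have hpow : ∀ {a c : ENNReal} {r q : ℝ}, 0 ≤ r → 2 * r = q →
      (a * c ^ 2) ^ r = a ^ r * c ^ q := by
    rintro a c r q hr rfl
    rw [ENNReal.mul_rpow_of_nonneg _ _ hr, ← ENNReal.rpow_natCast, ← ENNReal.rpow_mul]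
    norm_num
  have hx : x₁ * x₂ * x₃ =
      (x₁ ^ (3 / 2 : ℝ) * x₂ ^ (3 / 2 : ℝ) * (x₃ * x₃ ^ (1 / 2 : ℝ))) ^ (2 / 3 : ℝ) := by
    have h3 : x₃ * x₃ ^ (1 / 2 : ℝ) = x₃ ^ (3 / 2 : ℝ) := by
      nth_rewrite 1 [← ENNReal.rpow_one x₃]
      rw [← ENNReal.rpow_add_of_nonneg _ _ (by norm_num) (by norm_num)]
      norm_num
    rw [h3, ← ENNReal.mul_rpow_of_nonneg _ _ (by norm_num),
      ← ENNReal.mul_rpow_of_nonneg _ _ (by norm_num), ← ENNReal.rpow_mul]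
    norm_num
  rw [hx, ← ENNReal.mul_rpow_of_nonneg _ _ (by norm_num), ← ENNReal.rpow_mul, ← ENNReal.rpow_mul,
    hpow (r := 5 / 4 * (3 / 5)) (q := 3 / 2) (by norm_num) (by norm_num),
    hpow (r := 5 / 4 * (2 / 5)) (q := 1) (by norm_num) (by norm_num),
    hpow (r := 1 / 4) (q := 1 / 2) (by norm_num) (by norm_num),
    hpow (r := 3 / 4) (q := 3 / 2) (by norm_num) (by norm_num), ENNReal.rpow_one,
    show (5 / 4 * (3 / 5) : ℝ) = 3 / 4 by norm_num, show (5 / 4 * (2 / 5) : ℝ) = 1 / 2 by norm_num]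
  congr 1
  ring

/-- High-frequency trilinear L^{3/2} estimate in ℝ^{3+1}. -/
theorem statement_15 :
    ∀ s : ℝ, 5/6 < s → s < 1 →
    ∀ m₁ : Rn 3 → ℝ, IsAdmissibleMultiplier 3 s m₁ →
    ∃ ε₀ > (0:ℝ), ∀ ε : ℝ, 0 < ε → ε < ε₀ →
    ∃ C > (0:ℝ),
    ∀ φ₁ φ₂ φ₃ : SchwartzMap (Rn 3 × ℝ) ℂ,
    (∀ t : ℝ, Function.support (fun ξ => 𝓕 (fun x => φ₂ (x, t)) ξ) ⊆
        {ξ : Rn 3 | 1/2 ≤ ‖ξ‖}) →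
    (∀ t : ℝ, Function.support (fun ξ => 𝓕 (fun x => φ₃ (x, t)) ξ) ⊆
        {ξ : Rn 3 | 1/2 ≤ ‖ξ‖}) →
    lpNormST 3 (3/2) (fun x t =>
        (φ₂ (x, t) * φ₃ (x, t)) • gradC (Iop m₁ 1 (fun y => φ₁ (y, t))) x)
      ≤ C * XNorm 3 0 (1/2 + ε) (fun x t => gradC (Iop m₁ 1 (fun y => φ₁ (y, t))) x) *
          XNorm 3 0 (1/2 + ε) (fun x t => gradC (Iop m₁ 1 (fun y => φ₂ (y, t))) x) *
          XNorm 3 0 (1/2 + ε) (fun x t => gradC (Iop m₁ 1 (fun y => φ₃ (y, t))) x) := by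
  intro s hs hs1 m₁ hm
  refine ⟨1, one_pos, fun ε hε _ => ?_⟩
  set b : ℝ := 1 / 2 + ε with hb
  have hb2 : 1 / 2 < b := by linarith
  have hmt := hm.hasTemperateGrowth hs1.le
  set X : 𝓢(Rn 3 × ℝ, ℂ) → ℝ := fun φ =>
    XNorm 3 0 b (fun x t => gradC (Iop m₁ 1 (fun y => φ (y, t))) x) with hX
  have hX0 : ∀ φ, 0 ≤ X φ := fun φ => XNorm_nonneg _ _ _
  set K := curveConst b
  set B := modConst b
  set C : ENNReal := ((K ^ (3 / 4 : ℝ) * K ^ (1 / 2 : ℝ)) *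
    ((B * 4) ^ (1 / 4 : ℝ) * B ^ (3 / 4 : ℝ))) ^ (2 / 3 : ℝ) with hC
  have hCtop : C ≠ ⊤ := by
    have hK : K ≠ ⊤ := (curveConst_lt_top hb2).ne
    have hB : B ≠ ⊤ := (modConst_lt_top hb2).ne
    have hr : ∀ {a : ENNReal} {r : ℝ}, 0 ≤ r → a ≠ ⊤ → a ^ r ≠ ⊤ :=
      fun h ha => ENNReal.rpow_ne_top_of_nonneg h ha
    exact hr (by norm_num) (ENNReal.mul_ne_top
      (ENNReal.mul_ne_top (hr (by norm_num) hK) (hr (by norm_num) hK))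
      (ENNReal.mul_ne_top (hr (by norm_num) (ENNReal.mul_ne_top hB (by norm_num)))
        (hr (by norm_num) hB)))
  refine ⟨C.toReal + 1, by positivity, fun φ₁ φ₂ φ₃ h₂ h₃ => ?_⟩
  have hh₂ : highSq b φ₂ ≤ ENNReal.ofReal (X φ₂) ^ 2 := highSq_le (by linarith) hs1.le hm b h₂
  have hh₃ : highSq b φ₃ ≤ ENNReal.ofReal (X φ₃) ^ 2 := highSq_le (by linarith) hs1.le hm b h₃
  have hS : ∀ t, ∫⁻ x, ‖φ₃ (x, t)‖ₑ ^ 2 ≤ B * 4 * ENNReal.ofReal (X φ₃) ^ 2 := fun t =>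
    (lintegral_enorm_sq_slice_le b φ₃ t).trans (by
      rw [mul_assoc]
      gcongr
      exact (xSq_le_highSq b h₃).trans (by gcongr))
  have hmax : ∀ φ : 𝓢(Rn 3 × ℝ, ℂ), (∀ t : ℝ, Function.support
      (fun ξ => 𝓕 (fun x => φ (x, t)) ξ) ⊆ {ξ : Rn 3 | 1 / 2 ≤ ‖ξ‖}) →
      highSq b φ ≤ ENNReal.ofReal (X φ) ^ 2 →
      ∫⁻ t, maxAbs φ t ^ (5 / 2 : ℝ) ≤ (K * ENNReal.ofReal (X φ) ^ 2) ^ (5 / 4 : ℝ) :=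
    fun φ h hh => (lintegral_maxAbs_rpow_le b h).trans (by gcongr)
  have key := lintegral_trilinear_le φ₂ φ₃ (continuous_gradC_Iop hmt φ₁) hS
    (lintegral_enorm_sq_gradC_le hmt b φ₁)
  have hbound : ENNReal.ofReal (lpNormST 3 (3 / 2) (fun x t =>
      (φ₂ (x, t) * φ₃ (x, t)) • gradC (Iop m₁ 1 (fun y => φ₁ (y, t))) x)) ≤
      C * (ENNReal.ofReal (X φ₁) * ENNReal.ofReal (X φ₂) * ENNReal.ofReal (X φ₃)) := by
    refine (ofReal_lpNormST_le (by norm_num) _).trans ?_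
    have e : C * (ENNReal.ofReal (X φ₁) * ENNReal.ofReal (X φ₂) * ENNReal.ofReal (X φ₃))
        = ((((K * ENNReal.ofReal (X φ₂) ^ 2) ^ (5 / 4 : ℝ)) ^ (3 / 5 : ℝ) *
          ((K * ENNReal.ofReal (X φ₃) ^ 2) ^ (5 / 4 : ℝ)) ^ (2 / 5 : ℝ)) *
          ((B * 4 * ENNReal.ofReal (X φ₃) ^ 2) ^ (1 / 4 : ℝ) *
          (B * ENNReal.ofReal (X φ₁) ^ 2) ^ (3 / 4 : ℝ))) ^ (2 / 3 : ℝ) :=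
      trilinear_const_mul _ _ _ _ _ _
    rw [e]
    norm_num only [one_div_div]
    refine ENNReal.rpow_le_rpow (key.trans ?_) (by norm_num)
    gcongr
    · exact hmax φ₂ h₂ hh₂
    · exact hmax φ₃ h₃ hh₃
  have hnn : 0 ≤ X φ₁ * X φ₂ * X φ₃ := mul_nonneg (mul_nonneg (hX0 _) (hX0 _)) (hX0 _)
  rw [← ENNReal.ofReal_mul (hX0 _), ← ENNReal.ofReal_mul (mul_nonneg (hX0 _) (hX0 _)),
    ← ENNReal.ofReal_toReal hCtop, ← ENNReal.ofReal_mul ENNReal.toReal_nonneg,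
    ENNReal.ofReal_le_ofReal_iff (by positivity)] at hbound
  rw [mul_assoc, mul_assoc, ← mul_assoc (X φ₁)]
  linarith

end
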